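/- arXiv:1501.06362 — 8 statements merged into one kernel-verified Lean document; each statement's English description precedes it below -/
import Mathlib

section
/- Let k be an algebraically closed field of characteristic zero and let n ≥ 5. Then there exists a nonzero polynomial h ∈ k[c₁,…,c_{n−1}] such that for every point c = (c₁,…,c_{n−1}) ∈ k^{n−1} with h(c) ≠ 0, the radical of the ideal of k[x₁,…,xₙ] generated by s₁ − c₁, s₂ − c₂, …, s_{n−1} − c_{n−1} is a prime ideal; that is, the fiber φ⁻¹(c) of the morphism φ = (s₁,…,s_{n−1}) : 𝔸ⁿ → 𝔸^{n−1} is an irreducible curve for all c in a dense open subset of k^{n−1}. -/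
open Polynomial

/-- The value of the `j`-th elementary symmetric polynomial at a tuple. -/
def elemSymm {S : Type*} [CommRing S] {n : ℕ} (x : Fin n → S) (j : ℕ) : S :=
  (Finset.univ.val.map x).esymm j

/-- The polynomial `∑ (-1)^j d_j T^(n-j)`, which for `d_0 = 1` is the monic polynomial whose roots
have elementary symmetric functions `d_j`. -/
noncomputable def vietaPoly {S : Type*} [CommRing S] (n : ℕ) (d : ℕ → S) : S[X] :=
  ∑ j ∈ Finset.range (n + 1), C ((-1) ^ j * d j) * X ^ (n - j)

/-- The ideal `(s₁ - c₁, …, s_{n-1} - c_{n-1})`. -/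
noncomputable def fiberIdeal {k : Type*} [Field k] (n : ℕ) (c : ℕ → k) :
    Ideal (MvPolynomial (Fin n) k) :=
  Ideal.span (Set.range fun j : Fin (n - 1) =>
    MvPolynomial.esymm (Fin n) k ((j : ℕ) + 1) - MvPolynomial.C (c (j + 1)))

section Vieta

variable {S : Type*} [CommRing S] {n : ℕ}

lemma map_elemSymm {S' : Type*} [CommRing S'] (f : S →+* S') (x : Fin n → S) (j : ℕ) :
    f (elemSymm x j) = elemSymm (fun i => f (x i)) j := by
  simp only [elemSymm, Finset.esymm_map_val, map_sum, map_prod]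

lemma aeval_esymm_eq_elemSymm {R : Type*} [CommRing R] [Algebra R S] (x : Fin n → S) (j : ℕ) :
    MvPolynomial.aeval x (MvPolynomial.esymm (Fin n) R j) = elemSymm x j :=
  MvPolynomial.aeval_esymm_eq_multiset_esymm _ _ _ _

lemma eval_esymm_eq_elemSymm (x : Fin n → S) (j : ℕ) :
    MvPolynomial.eval x (MvPolynomial.esymm (Fin n) S j) = elemSymm x j := by
  rw [← aeval_esymm_eq_elemSymm (R := S), MvPolynomial.aeval_eq_eval]

lemma elemSymm_zero (x : Fin n → S) : elemSymm x 0 = 1 := by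
  rw [elemSymm, Finset.esymm_map_val]
  simp

lemma elemSymm_one (x : Fin n → S) : elemSymm x 1 = ∑ i, x i := by
  rw [elemSymm, Finset.esymm_map_val]
  simp [Finset.powersetCard_one]

lemma elemSymm_comp_perm (x : Fin n → S) (σ : Equiv.Perm (Fin n)) (j : ℕ) :
    elemSymm (x ∘ σ) j = elemSymm x j := by
  have := Multiset.map_univ_val_equiv σ
  rw [elemSymm, elemSymm, ← Multiset.map_map, this]

lemma elemSymm_mul_left (a : S) (x : Fin n → S) (j : ℕ) :
    elemSymm (fun i => a * x i) j = a ^ j * elemSymm x j := by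
  simp only [elemSymm, Finset.esymm_map_val, Finset.prod_mul_distrib, Finset.mul_sum]
  refine Finset.sum_congr rfl fun t ht => ?_
  rw [Finset.prod_const, (Finset.mem_powersetCard.1 ht).2]

lemma prod_X_sub_C_eq_vietaPoly (x : Fin n → S) :
    ∏ i, (X - C (x i)) = vietaPoly n (elemSymm x) := by
  have := Multiset.prod_X_sub_X_eq_sum_esymm (Finset.univ.val.map x)
  rw [Multiset.map_map] at this
  refine Eq.trans this ?_
  rw [vietaPoly]
  simp [elemSymm, mul_assoc]

lemma coeff_vietaPoly (d : ℕ → S) {j : ℕ} (hj : j ≤ n) :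
    (vietaPoly n d).coeff (n - j) = (-1) ^ j * d j := by
  simp only [vietaPoly, finsetSum_coeff, coeff_C_mul_X_pow]
  rw [Finset.sum_eq_single_of_mem j (by simpa [Nat.lt_succ_iff] using hj)]
  · simp
  · intro i hi hij
    rw [if_neg]
    have := Finset.mem_range.1 hi
    omega

lemma vietaPoly_congr {d d' : ℕ → S} (h : ∀ j ≤ n, d j = d' j) :
    vietaPoly n d = vietaPoly n d' := by
  refine Finset.sum_congr rfl fun j hj => ?_
  rw [h j (Nat.lt_succ_iff.1 (Finset.mem_range.1 hj))]

lemma eq_of_vietaPoly_eq {d d' : ℕ → S} (h : vietaPoly n d = vietaPoly n d') {j : ℕ}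
    (hj : j ≤ n) : d j = d' j := by
  have h1 := coeff_vietaPoly d hj
  rw [h, coeff_vietaPoly d' hj] at h1
  have h2 : IsUnit ((-1 : S) ^ j) := (isUnit_one.neg).pow j
  exact (h2.mul_left_cancel h1).symm

lemma vietaPoly_eq_add (d : ℕ → S) (t : S) :
    vietaPoly n (Function.update d n t) =
      vietaPoly n (Function.update d n 0) + C ((-1) ^ n * t) := by
  simp only [vietaPoly, Finset.sum_range_succ, Function.update_self]
  have : ∀ t, ∑ j ∈ Finset.range n, C ((-1) ^ j * Function.update d n t j) * X ^ (n - j) =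
      ∑ j ∈ Finset.range n, C ((-1) ^ j * d j) * X ^ (n - j) := fun t =>
    Finset.sum_congr rfl fun j hj => by
      rw [Function.update_of_ne (Finset.mem_range.1 hj).ne]
  rw [this, this]
  simp

lemma natDegree_vietaPoly_le (d : ℕ → S) : (vietaPoly n d).natDegree ≤ n := by
  refine natDegree_sum_le_of_forall_le _ _ fun j _ => ?_
  exact (natDegree_C_mul_X_pow_le _ _).trans (Nat.sub_le _ _)

lemma vietaPoly_monic {d : ℕ → S} (hd : d 0 = 1) : (vietaPoly n d).Monic := by
  refine monic_of_natDegree_le_of_coeff_eq_one n (natDegree_vietaPoly_le d) ?_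
  simpa [hd] using coeff_vietaPoly d (Nat.zero_le n)

lemma natDegree_vietaPoly [Nontrivial S] {d : ℕ → S} (hd : d 0 = 1) :
    (vietaPoly n d).natDegree = n := by
  refine natDegree_eq_of_le_of_coeff_ne_zero (natDegree_vietaPoly_le d) ?_
  have := coeff_vietaPoly d (Nat.zero_le n)
  simp only [Nat.sub_zero, pow_zero, hd, mul_one] at this
  rw [this]; exact one_ne_zero

lemma map_vietaPoly {S' : Type*} [CommRing S'] (f : S →+* S') (d : ℕ → S) :
    (vietaPoly n d).map f = vietaPoly n (fun j => f (d j)) := by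
  simp [vietaPoly, Polynomial.map_sum]

lemma exists_vietaPoly_eq_prod {k : Type*} [Field k] [IsAlgClosed k] {d : ℕ → k} (hd : d 0 = 1) :
    ∃ x : Fin n → k, vietaPoly n d = ∏ i, (X - C (x i)) := by
  have hs := IsAlgClosed.splits (vietaPoly n d)
  have hcard : Multiset.card (vietaPoly n d).roots = n := by
    rw [← hs.natDegree_eq_card_roots, natDegree_vietaPoly hd]
  have hp := hs.eq_prod_roots_of_monic (vietaPoly_monic hd)
  obtain ⟨l, hl⟩ := Quot.exists_rep (vietaPoly n d).roots
  have hl' : (l : Multiset k) = (vietaPoly n d).roots := hl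
  rw [← hl'] at hcard hp
  have hlen : l.length = n := by simpa using hcard
  subst hlen
  refine ⟨l.get, ?_⟩
  conv_lhs => rw [hp]
  rw [Multiset.map_coe, Multiset.prod_coe, ← List.prod_ofFn]
  congr 1
  conv_lhs => rw [← List.ofFn_get l, List.map_ofFn]
  rfl

/-- A tuple on which `s₁,…,s_{n-1}` take the values `c₁,…,c_{n-1}` is the tuple of
roots of the corresponding polynomial. -/
lemma prod_X_sub_C_eq_of_elemSymm {x : Fin n → S} {c : ℕ → S} (hc : c 0 = 1)
    (h : ∀ j, 0 < j → j < n → elemSymm x j = c j) :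
    ∏ i, (X - C (x i)) = vietaPoly n (Function.update c n (elemSymm x n)) := by
  rw [prod_X_sub_C_eq_vietaPoly]
  refine vietaPoly_congr fun j hj => ?_
  rcases hj.eq_or_lt with rfl | hj
  · simp
  · rw [Function.update_of_ne hj.ne]
    rcases Nat.eq_zero_or_pos j with rfl | h0
    · rw [elemSymm_zero, hc]
    · exact h j h0 hj

lemma elemSymm_of_vietaPoly_eq_prod {x : Fin n → S} {d : ℕ → S}
    (h : vietaPoly n d = ∏ i, (X - C (x i))) {j : ℕ} (hj : j ≤ n) : elemSymm x j = d j :=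
  eq_of_vietaPoly_eq (by rw [← prod_X_sub_C_eq_vietaPoly, h]) hj

/-- For all but finitely many constant terms, the polynomial has simple roots. -/
lemma finite_setOf_not_injective {k : Type*} [Field k] [CharZero k] (hn : n ≠ 0)
    {d : ℕ → k} (hd : d 0 = 1) :
    {t : k | ∃ x : Fin n → k, vietaPoly n (Function.update d n t) = ∏ i, (X - C (x i)) ∧
      ¬ Function.Injective x}.Finite := by
  classical
  set Q := vietaPoly n (Function.update d n 0)
  have hQ : Q.natDegree = n := natDegree_vietaPoly (by rw [Function.update_of_ne hn.symm, hd])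
  have hQ' : derivative Q ≠ 0 := by
    intro h
    have := derivative_eq_zero.1 h
    omega
  refine (((derivative Q).roots.toFinset.image fun a => -((-1) ^ n * Q.eval a)).finite_toSet).subset
    ?_
  rintro t ⟨x, hx, hinj⟩
  rw [vietaPoly_eq_add] at hx
  obtain ⟨i, j, hij, hne⟩ : ∃ i j, x i = x j ∧ i ≠ j := by
    simpa [Function.Injective] using hinj
  have hdvd : (X - C (x i)) ^ 2 ∣ Q + C ((-1) ^ n * t) := by
    rw [hx, ← Finset.mul_prod_erase _ _ (Finset.mem_univ i),
      ← Finset.mul_prod_erase _ _ (Finset.mem_erase.2 ⟨hne.symm, Finset.mem_univ j⟩), ← hij,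
      ← mul_assoc, ← sq]
    exact dvd_mul_right _ _
  obtain ⟨G, hG⟩ := hdvd
  have h1 : (Q + C ((-1) ^ n * t)).eval (x i) = 0 := by rw [hG]; simp
  have h2 : (derivative (Q + C ((-1) ^ n * t))).eval (x i) = 0 := by
    rw [hG]
    simp [sq]
  simp only [eval_add, eval_C, derivative_add, derivative_C, add_zero] at h1 h2
  simp only [Finset.coe_image, Set.mem_image, Finset.mem_coe, Multiset.mem_toFinset]
  refine ⟨x i, (mem_roots hQ').2 h2, ?_⟩
  rw [eq_neg_of_add_eq_zero_left h1, mul_neg, neg_neg, ← mul_assoc, ← pow_add, ← two_mul,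
    pow_mul]
  simp

end Vieta

section Spanning

open scoped Pointwise in
/-- If `C` is generated over `R` by the roots `x₁,…,xₘ` of a monic polynomial over `R`, then
it is spanned by `m!` elements. -/
lemma exists_finset_card_le_factorial_span_eq_top.{u} {A : Type u} [CommRing A] (m : ℕ) :
    ∀ (R : Type u) [CommRing R] [Algebra R A] (x : Fin m → A)
      (_ : ∃ F : R[X], F.Monic ∧ F.map (algebraMap R A) = ∏ i, (X - C (x i)))
      (_ : Algebra.adjoin R (Set.range x) = ⊤),
      ∃ s : Finset A, s.card ≤ m.factorial ∧ Submodule.span R (s : Set A) = ⊤ := by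
  classical
  induction m with
  | zero =>
    intro R _ _ x _ hx
    refine ⟨{1}, by simp, ?_⟩
    rw [Set.range_eq_empty, Algebra.adjoin_empty] at hx
    rw [Finset.coe_singleton, ← Submodule.one_eq_span, ← Algebra.toSubmodule_bot, hx,
      Algebra.top_toSubmodule]
  | succ m ih =>
    rintro R _ _ x ⟨F, hFm, hF⟩ hx
    rcases subsingleton_or_nontrivial A with hA | hA
    · exact ⟨∅, by simp, Subsingleton.elim _ _⟩
    have hmonic (m : ℕ) (y : Fin m → A) : (∏ i, (X - C (y i))).Monic :=
      monic_prod_of_monic _ _ fun i _ => monic_X_sub_C _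
    let R' := Algebra.adjoin R {x 0}
    let a : R' := ⟨x 0, Algebra.self_mem_adjoin_singleton R _⟩
    have hinj : Function.Injective (algebraMap R' A) := Subtype.val_injective
    have hmap : (F.map (algebraMap R R')).map (algebraMap R' A) = ∏ i, (X - C (x i)) := by
      rw [Polynomial.map_map, ← IsScalarTower.algebraMap_eq, hF]
    have ha : (F.map (algebraMap R R')).IsRoot a := by
      refine hinj ?_
      rw [map_zero, ← eval_map_apply, hmap, Fin.prod_univ_succ, eval_mul]
      have : algebraMap R' A a = x 0 := rfl
      simp [this]
    obtain ⟨G, hG⟩ := dvd_iff_isRoot.2 ha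
    have hG' : G.map (algebraMap R' A) = ∏ i : Fin m, (X - C (x i.succ)) := by
      rw [hG, Polynomial.map_mul, Fin.prod_univ_succ] at hmap
      refine (monic_X_sub_C (x 0)).isRegular.left ?_
      refine Eq.trans ?_ hmap
      simp only [Polynomial.map_sub, map_X, map_C]
      rfl
    have hGm : G.Monic := by
      refine monic_of_injective hinj ?_
      rw [hG']
      exact hmonic _ _
    obtain ⟨s, hs, hspan⟩ := ih R' (fun i => x i.succ) ⟨G, hGm, hG'⟩ (by
      refine eq_top_iff.2 fun y _ => ?_
      have hy : y ∈ Algebra.adjoin R (Set.range x) := hx ▸ Algebra.mem_top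
      induction hy using Algebra.adjoin_induction with
      | mem y hy =>
        obtain ⟨i, rfl⟩ := hy
        refine Fin.cases ?_ (fun i => ?_) i
        · exact (Algebra.adjoin R' _).algebraMap_mem a
        · exact Algebra.subset_adjoin ⟨i, rfl⟩
      | algebraMap r => exact (Algebra.adjoin R' _).algebraMap_mem (algebraMap R R' r)
      | add y z _ _ hy hz => exact add_mem (hy Algebra.mem_top) (hz Algebra.mem_top)
      | mul y z _ _ hy hz => exact mul_mem (hy Algebra.mem_top) (hz Algebra.mem_top))
    have hFx : aeval (x 0) F = 0 := by
      rw [aeval_def, ← eval_map, hF, Fin.prod_univ_succ]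
      simp
    have hdeg : F.natDegree = m + 1 := by
      rw [← hFm.natDegree_map (algebraMap R A), hF, natDegree_prod_of_monic _ _
        (fun i _ => monic_X_sub_C _)]
      simp
    let p : Finset R' := (Finset.range (m + 1)).image (a ^ ·)
    have hp : Submodule.span R (p : Set R') = ⊤ := by
      have h1 := Submodule.span_range_natDegree_eq_adjoin hFm hFx
      rw [hdeg] at h1
      refine Submodule.map_injective_of_injective (f := R'.val.toLinearMap) hinj ?_
      rw [Submodule.map_span, Submodule.map_top]
      have h2 : LinearMap.range R'.val.toLinearMap = Subalgebra.toSubmodule R' := by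
        ext; simp
      rw [h2, ← h1]
      congr 1
      ext z
      simp [p, a]
    refine ⟨p • s, ?_, ?_⟩
    · refine Finset.card_smul_le.trans ?_
      rw [Nat.factorial_succ]
      exact Nat.mul_le_mul (Finset.card_image_le.trans (by simp)) hs
    · rw [Finset.coe_smul, Submodule.span_smul_of_span_eq_top hp, hspan,
        Submodule.restrictScalars_top]

end Spanning

section Radical

variable {k : Type*} [Field k] {n : ℕ}

lemma esymm_sub_C_mem_fiberIdeal (c : ℕ → k) {j : ℕ} (h0 : 0 < j) (hj : j < n) :
    MvPolynomial.esymm (Fin n) k j - MvPolynomial.C (c j) ∈ fiberIdeal n c := by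
  obtain ⟨i, rfl⟩ := Nat.exists_eq_succ_of_ne_zero h0.ne'
  exact Ideal.subset_span ⟨⟨i, by omega⟩, rfl⟩

lemma fiberIdeal_le_ker {S : Type*} [CommRing S] [Algebra k S] {c : ℕ → k} {x : Fin n → S}
    (h : ∀ j, 0 < j → j < n → elemSymm x j = algebraMap k S (c j)) :
    fiberIdeal n c ≤ RingHom.ker (MvPolynomial.aeval (R := k) x) := by
  refine Ideal.span_le.2 ?_
  rintro _ ⟨j, rfl⟩
  have hj : (j : ℕ) + 1 < n := by omega
  simp [RingHom.mem_ker, aeval_esymm_eq_elemSymm, h _ (Nat.succ_pos _) hj]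

lemma eval_eq_zero_of_mem_fiberIdeal {c : ℕ → k} {x : Fin n → k}
    (h : ∀ j, 0 < j → j < n → elemSymm x j = c j) {f : MvPolynomial (Fin n) k}
    (hf : f ∈ fiberIdeal n c) : MvPolynomial.eval x f = 0 := by
  have := fiberIdeal_le_ker (S := k) (by simpa using h) hf
  simpa [RingHom.mem_ker, MvPolynomial.aeval_eq_eval] using this

lemma elemSymm_mk_X {c : ℕ → k} {j : ℕ} :
    elemSymm (fun i => Ideal.Quotient.mk (fiberIdeal n c) (MvPolynomial.X i)) j =
      Ideal.Quotient.mk (fiberIdeal n c) (MvPolynomial.esymm (Fin n) k j) := by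
  rw [← map_elemSymm, ← aeval_esymm_eq_elemSymm (R := k), MvPolynomial.aeval_X_left_apply]

lemma elemSymm_mk_X_of_lt {c : ℕ → k} {j : ℕ} (h0 : 0 < j) (hj : j < n) :
    elemSymm (fun i => Ideal.Quotient.mk (fiberIdeal n c) (MvPolynomial.X i)) j =
      algebraMap k (MvPolynomial (Fin n) k ⧸ fiberIdeal n c) (c j) := by
  rw [elemSymm_mk_X]
  exact Ideal.Quotient.eq.2 (esymm_sub_C_mem_fiberIdeal c h0 hj)

/-- Modulo the ideal of a fiber, every polynomial is a combination of `n!` fixed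
polynomials with coefficients that are polynomials in `sₙ`. -/
lemma exists_spanning_family (hn : n ≠ 0) {c : ℕ → k} (hc : c 0 = 1) :
    ∃ m ≤ n.factorial, ∃ e : Fin m → MvPolynomial (Fin n) k, ∀ f, ∃ g : Fin m → k[X],
      f - ∑ i, aeval (MvPolynomial.esymm (Fin n) k n) (g i) * e i ∈ fiberIdeal n c := by
  let A := MvPolynomial (Fin n) k ⧸ fiberIdeal n c
  let π : MvPolynomial (Fin n) k →ₐ[k] A := Ideal.Quotient.mkₐ k _
  let φ : k[X] →ₐ[k] A := aeval (π (MvPolynomial.esymm (Fin n) k n))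
  let _ : Algebra k[X] A := φ.toRingHom.toAlgebra
  have hφ (p : k[X]) : algebraMap k[X] A p = π (aeval (MvPolynomial.esymm (Fin n) k n) p) :=
    aeval_algHom_apply π _ p
  let x : Fin n → A := fun i => π (MvPolynomial.X i)
  obtain ⟨s, hs, hspan⟩ := exists_finset_card_le_factorial_span_eq_top (A := A) n k[X] x (by
    refine ⟨vietaPoly n (Function.update (fun j => C (c j)) n X), ?_, ?_⟩
    · exact vietaPoly_monic (by rw [Function.update_of_ne hn.symm, hc, C_1])
    · rw [map_vietaPoly, prod_X_sub_C_eq_of_elemSymm (x := x) (c := fun j => algebraMap k A (c j))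
        (by simp [hc]) (fun j h0 hj => elemSymm_mk_X_of_lt h0 hj)]
      refine vietaPoly_congr fun j hj => ?_
      rcases hj.eq_or_lt with rfl | hj
      · simp only [Function.update_self]
        rw [hφ, aeval_X]
        exact elemSymm_mk_X.symm
      · rw [Function.update_of_ne hj.ne, Function.update_of_ne hj.ne, hφ, aeval_C]
        rfl) (by
    refine eq_top_iff.2 fun y _ => ?_
    obtain ⟨f, rfl⟩ := Ideal.Quotient.mk_surjective y
    induction f using MvPolynomial.induction_on with
    | C a =>
      have := (Algebra.adjoin k[X] (Set.range x)).algebraMap_mem (C a)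
      rwa [hφ, aeval_C] at this
    | add p q hp hq => rw [map_add]; exact add_mem (hp Algebra.mem_top) (hq Algebra.mem_top)
    | mul_X p i hp =>
      rw [map_mul]
      exact mul_mem (hp Algebra.mem_top) (Algebra.subset_adjoin ⟨i, rfl⟩))
  choose r hr using Ideal.Quotient.mk_surjective (I := fiberIdeal n c)
  refine ⟨s.card, hs, fun i => r (s.equivFin.symm i), fun f => ?_⟩
  have hf : (Ideal.Quotient.mk _ f : A) ∈ Submodule.span k[X] (Set.range fun i =>
      (s.equivFin.symm i : A)) := by
    have : (Set.range fun i => (s.equivFin.symm i : A)) = s := by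
      rw [Set.range_comp' Subtype.val, s.equivFin.symm.surjective.range_eq]
      simp
    rw [this, hspan]
    trivial
  obtain ⟨g, hg⟩ := (Submodule.mem_span_range_iff_exists_fun _).1 hf
  refine ⟨g, Ideal.Quotient.eq.1 ?_⟩
  rw [← hg, map_sum]
  refine Finset.sum_congr rfl fun i _ => ?_
  rw [Algebra.smul_def, hφ, map_mul, hr]
  rfl

/-- Any function on the orderings of `n` distinct scalars is given by a polynomial. -/
lemma exists_eval_comp_perm_eq {x : Fin n → k} (hx : Function.Injective x)
    (φ : Equiv.Perm (Fin n) → k) :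
    ∃ f : MvPolynomial (Fin n) k, ∀ σ : Equiv.Perm (Fin n), MvPolynomial.eval (x ∘ σ) f = φ σ := by
  classical
  have hsep (σ τ : Equiv.Perm (Fin n)) : ∃ f : MvPolynomial (Fin n) k, σ ≠ τ →
      MvPolynomial.eval (x ∘ σ) f = 1 ∧ MvPolynomial.eval (x ∘ τ) f = 0 := by
    by_cases h : σ = τ
    · exact ⟨0, fun h' => (h' h).elim⟩
    obtain ⟨i, hi⟩ : ∃ i, σ i ≠ τ i := by
      by_contra! H
      exact h (Equiv.ext H)
    have hne : x (σ i) - x (τ i) ≠ 0 := sub_ne_zero.2 (hx.ne hi)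
    refine ⟨MvPolynomial.C (x (σ i) - x (τ i))⁻¹ * (MvPolynomial.X i - MvPolynomial.C (x (τ i))),
      fun _ => ?_⟩
    simp [inv_mul_cancel₀ hne]
  choose p hp using hsep
  refine ⟨∑ σ, MvPolynomial.C (φ σ) * ∏ τ ∈ Finset.univ.erase σ, p σ τ, fun σ => ?_⟩
  rw [map_sum, Finset.sum_eq_single σ]
  · rw [map_mul, MvPolynomial.eval_C, map_prod, Finset.prod_eq_one, mul_one]
    exact fun τ hτ => (hp σ τ (Finset.ne_of_mem_erase hτ).symm).1
  · intro τ _ hτ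
    rw [map_mul, map_prod, Finset.prod_eq_zero (Finset.mem_erase.2 ⟨hτ.symm, Finset.mem_univ σ⟩),
      mul_zero]
    exact (hp τ σ hτ).2
  · simp

/-- A polynomial vanishing on a fiber lies in the ideal of that fiber. -/
lemma mem_fiberIdeal_of_eval_eq_zero [IsAlgClosed k] [CharZero k] (hn : n ≠ 0) {c : ℕ → k}
    (hc : c 0 = 1) {f : MvPolynomial (Fin n) k}
    (hf : ∀ x : Fin n → k, (∀ j, 0 < j → j < n → elemSymm x j = c j) →
      MvPolynomial.eval x f = 0) : f ∈ fiberIdeal n c := by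
  obtain ⟨m, hm, e, he⟩ := exists_spanning_family hn hc
  obtain ⟨g, hg⟩ := he f
  suffices h : g = 0 by simpa [h] using hg
  funext i
  refine eq_of_infinite_eval_eq _ _ ((finite_setOf_not_injective hn hc).infinite_compl.mono ?_)
  intro t ht
  have hd : Function.update c n t 0 = 1 := by rw [Function.update_of_ne hn.symm, hc]
  obtain ⟨x, hx⟩ := exists_vietaPoly_eq_prod (n := n) hd
  have hinj : Function.Injective x := by
    by_contra h
    exact ht ⟨x, hx, h⟩
  have hxc (σ : Equiv.Perm (Fin n)) (j : ℕ) (_ : 0 < j) (hj : j < n) :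
      elemSymm (x ∘ σ) j = c j := by
    rw [elemSymm_comp_perm, elemSymm_of_vietaPoly_eq_prod hx hj.le, Function.update_of_ne hj.ne]
  have hxt (σ : Equiv.Perm (Fin n)) : elemSymm (x ∘ σ) n = t := by
    rw [elemSymm_comp_perm, elemSymm_of_vietaPoly_eq_prod hx le_rfl, Function.update_self]
  have hexpand (f : MvPolynomial (Fin n) k) (g : Fin m → k[X])
      (h : f - ∑ i, aeval (MvPolynomial.esymm (Fin n) k n) (g i) * e i ∈ fiberIdeal n c)
      (σ : Equiv.Perm (Fin n)) :
      MvPolynomial.eval (x ∘ σ) f = ∑ i, (g i).eval t * MvPolynomial.eval (x ∘ σ) (e i) := by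
    have := eval_eq_zero_of_mem_fiberIdeal (hxc σ) h
    rw [map_sub, sub_eq_zero] at this
    rw [this, map_sum]
    refine Finset.sum_congr rfl fun i _ => ?_
    rw [map_mul, ← MvPolynomial.aeval_eq_eval, ← aeval_algHom_apply, aeval_esymm_eq_elemSymm, hxt]
    simp
  let b : Fin m → Equiv.Perm (Fin n) → k := fun i σ => MvPolynomial.eval (x ∘ σ) (e i)
  have hspan : ⊤ ≤ Submodule.span k (Set.range b) := by
    rintro φ -
    obtain ⟨f, hf⟩ := exists_eval_comp_perm_eq hinj φ
    obtain ⟨g, hg⟩ := he f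
    refine (Submodule.mem_span_range_iff_exists_fun k).2 ⟨fun i => (g i).eval t, ?_⟩
    funext σ
    rw [← hf, hexpand f g hg]
    simp [b]
  have hrank : Module.finrank k (Equiv.Perm (Fin n) → k) = n.factorial := by
    rw [Module.finrank_pi, Fintype.card_perm, Fintype.card_fin]
  have hli : LinearIndependent k b := by
    refine linearIndependent_of_top_le_span_of_card_eq_finrank hspan
      (le_antisymm (by simpa [hrank] using hm) ?_)
    rw [← finrank_top k, ← top_le_iff.1 hspan]
    exact finrank_range_le_card b
  have := Fintype.linearIndependent_iff.1 hli (fun i => (g i).eval t) (by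
    funext σ
    have h1 := hexpand f g hg σ
    rw [hf _ (hxc σ)] at h1
    simpa [b] using h1.symm) i
  simpa using this

end Radical

section Infinity

variable {k : Type*} [Field k] {n : ℕ}

lemma vietaPoly_eq_X_pow_sub_C (hn : n ≠ 0) {d : ℕ → k} (hd : d 0 = 1)
    (h : ∀ j, 0 < j → j < n → d j = 0) :
    vietaPoly n d = X ^ n - C (-((-1) ^ n * d n)) := by
  obtain ⟨m, rfl⟩ := Nat.exists_eq_succ_of_ne_zero hn
  rw [vietaPoly, Finset.sum_range_succ, Finset.sum_range_succ', Finset.sum_eq_zero]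
  · simp [hd]
  · intro j hj
    rw [h _ (Nat.succ_pos j) (by simpa using hj)]
    simp

lemma separable_prod_X_sub_C_of_elemSymm_eq_zero [CharZero k] (hn : n ≠ 0) {y : Fin n → k}
    (hy : ∀ j, 0 < j → j < n → elemSymm y j = 0) (hy0 : y ≠ 0) :
    (∏ i, (X - C (y i))).Separable := by
  have h := prod_X_sub_C_eq_vietaPoly y
  rw [vietaPoly_eq_X_pow_sub_C hn (elemSymm_zero y) hy] at h
  rw [h]
  refine separable_X_pow_sub_C _ (Nat.cast_ne_zero.2 hn) fun h0 => hy0 ?_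
  funext i
  have h1 := congrArg (eval (y i)) h
  rw [h0, eval_prod, Finset.prod_eq_zero (Finset.mem_univ i) (by simp)] at h1
  simpa [hn] using h1.symm

/-- Every nonzero common zero of `s₁,…,s_{n-1}` is the direction of a branch at infinity
of the fiber over `c`: by Hensel's lemma the rescaled equations can be solved in power series. -/
lemma exists_powerSeries_branch [CharZero k] (hn : n ≠ 0) {y : Fin n → k}
    (hy : ∀ j, 0 < j → j < n → elemSymm y j = 0) (hy0 : y ≠ 0) {c : ℕ → k} (hc : c 0 = 1) :
    ∃ u : Fin n → PowerSeries k,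
      (∀ j, 0 < j → j < n → elemSymm u j = PowerSeries.C (c j) * PowerSeries.X ^ j) ∧
      ∀ i, PowerSeries.constantCoeff (u i) = y i := by
  have hsep := separable_prod_X_sub_C_of_elemSymm_eq_zero hn hy hy0
  have hinj := separable_prod_X_sub_C_iff.1 hsep
  let d : ℕ → PowerSeries k := Function.update (fun j => PowerSeries.C (c j) * PowerSeries.X ^ j) n
    (PowerSeries.C (elemSymm y n))
  have hd0 : d 0 = 1 := by simp [d, Function.update_of_ne hn.symm, hc]
  have hmap : (vietaPoly n d).map PowerSeries.constantCoeff = ∏ i, (X - C (y i)) := by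
    rw [map_vietaPoly, prod_X_sub_C_eq_vietaPoly]
    refine vietaPoly_congr fun j hj => ?_
    rcases hj.eq_or_lt with rfl | hj
    · simp [d]
    · simp only [d, Function.update_of_ne hj.ne]
      rcases Nat.eq_zero_or_pos j with rfl | h0
      · simp [elemSymm_zero, hc]
      · simp [hy j h0 hj, h0.ne']
  have hroot (i : Fin n) : ∃ u : PowerSeries k, (vietaPoly n d).IsRoot u ∧
      PowerSeries.constantCoeff u = y i := by
    have hev : (∏ i, (X - C (y i))).eval (y i) = 0 := by
      rw [eval_prod, Finset.prod_eq_zero (Finset.mem_univ i) (by simp)]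
    have hcc (f : (PowerSeries k)[X]) : PowerSeries.constantCoeff (f.eval (PowerSeries.C (y i))) =
        (f.map PowerSeries.constantCoeff).eval (y i) := by
      rw [← eval_map_apply, PowerSeries.constantCoeff_C]
    obtain ⟨u, hu, hu'⟩ := HenselianRing.is_henselian
      (I := Ideal.span {(PowerSeries.X : PowerSeries k)}) (vietaPoly n d) (vietaPoly_monic hd0)
      (PowerSeries.C (y i))
      (by rw [Ideal.mem_span_singleton, PowerSeries.X_dvd_iff, hcc, hmap, hev])
      (by
        refine IsUnit.map _ ?_
        rw [PowerSeries.isUnit_iff_constantCoeff, hcc, ← derivative_map, hmap, isUnit_iff_ne_zero]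
        exact hsep.eval₂_derivative_ne_zero (RingHom.id k) (by simpa using hev))
    refine ⟨u, hu, ?_⟩
    rw [Ideal.mem_span_singleton, PowerSeries.X_dvd_iff, map_sub, sub_eq_zero] at hu'
    simpa using hu'
  choose u hu hu' using hroot
  have hui : Function.Injective u := fun i j hij => hinj (by rw [← hu', ← hu', hij])
  have hprod : vietaPoly n d = ∏ i, (X - C (u i)) := by
    refine eq_of_monic_of_dvd_of_natDegree_le
      (monic_prod_of_monic _ _ fun i _ => monic_X_sub_C _) (vietaPoly_monic hd0) ?_ ?_
    · have h := (Multiset.prod_X_sub_C_dvd_iff_le_roots (vietaPoly_monic hd0).ne_zero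
        (Finset.univ.val.map u)).2 ((Multiset.le_iff_subset
          (Finset.univ.nodup.map hui)).2 fun z hz => by
            obtain ⟨i, -, rfl⟩ := Multiset.mem_map.1 hz
            exact (mem_roots (vietaPoly_monic hd0).ne_zero).2 (hu i))
      rwa [Multiset.map_map] at h
    · rw [natDegree_vietaPoly hd0, natDegree_prod_of_monic _ _ (fun i _ => monic_X_sub_C _)]
      simp
  refine ⟨u, fun j _ hj => ?_, hu'⟩
  rw [elemSymm_of_vietaPoly_eq_prod hprod hj.le]
  simp [d, Function.update_of_ne hj.ne]

/-- If `a` is idempotent modulo the radical of the ideal of a fiber, then its leading form vanishes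
at all common zeros of `s₁,…,s_{n-1}`. -/
lemma eval_homogeneousComponent_eq_zero [CharZero k] (hn : n ≠ 0) {y : Fin n → k}
    (hy : ∀ j, 0 < j → j < n → elemSymm y j = 0) {c : ℕ → k} (hc : c 0 = 1)
    {a : MvPolynomial (Fin n) k} (ha : a * (1 - a) ∈ (fiberIdeal n c).radical) {d : ℕ}
    (hd : d ≠ 0) (had : a.totalDegree ≤ d) :
    MvPolynomial.eval y (MvPolynomial.homogeneousComponent d a) = 0 := by
  by_cases hy0 : y = 0
  · rw [hy0, MvPolynomial.eval_zero, MvPolynomial.constantCoeff_eq]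
    exact (MvPolynomial.homogeneousComponent_isHomogeneous d a).coeff_eq_zero
      (by simpa using hd.symm)
  obtain ⟨u, hu, huy⟩ := exists_powerSeries_branch hn hy hy0 hc
  let K := FractionRing (PowerSeries k)
  let ι := algebraMap (PowerSeries k) K
  have hιi : Function.Injective ι := IsFractionRing.injective _ _
  have hι (r : k) : algebraMap k K r = ι (PowerSeries.C r) := rfl
  have hτ : ι PowerSeries.X ≠ 0 := (map_ne_zero_iff ι hιi).2 PowerSeries.X_ne_zero
  let w : Fin n → K := fun i => (ι PowerSeries.X)⁻¹ * ι (u i)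
  have hw : ∀ j, 0 < j → j < n → elemSymm w j = algebraMap k K (c j) := by
    intro j h0 hj
    rw [elemSymm_mul_left, ← map_elemSymm, hu j h0 hj, map_mul, map_pow, hι, mul_left_comm,
      ← mul_pow, inv_mul_cancel₀ hτ, one_pow, mul_one]
  obtain ⟨N, hN⟩ := ha
  have haw : MvPolynomial.aeval w a = 0 ∨ MvPolynomial.aeval w a = 1 := by
    have h := fiberIdeal_le_ker hw hN
    rw [RingHom.mem_ker, map_pow] at h
    have h' := eq_zero_of_pow_eq_zero h
    rw [map_mul, map_sub, map_one, mul_eq_zero, sub_eq_zero] at h'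
    exact h'.imp id Eq.symm
  let H : PowerSeries k := ∑ s ∈ a.support, PowerSeries.C (a.coeff s) *
    (PowerSeries.X ^ (d - s.degree) * ∏ i, u i ^ s i)
  have hHw : ι H = ι PowerSeries.X ^ d * MvPolynomial.aeval w a := by
    rw [MvPolynomial.aeval_def, MvPolynomial.eval₂_eq', Finset.mul_sum, map_sum]
    refine Finset.sum_congr rfl fun s hs => ?_
    have hsd : s.degree ≤ d := (MvPolynomial.le_totalDegree hs).trans had
    simp only [w, map_mul, map_pow, map_prod, mul_pow, Finset.prod_mul_distrib,
      Finset.prod_pow_eq_pow_sum, hι]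
    have h1 : ι PowerSeries.X ^ d =
        ι PowerSeries.X ^ (d - s.degree) * ι PowerSeries.X ^ s.degree := by
      rw [← pow_add, Nat.sub_add_cancel hsd]
    have h2 : ι PowerSeries.X ^ s.degree * (ι PowerSeries.X)⁻¹ ^ s.degree = 1 := by
      rw [← mul_pow, mul_inv_cancel₀ hτ, one_pow]
    rw [← Finsupp.degree_eq_sum, h1]
    linear_combination (-(ι (PowerSeries.C (a.coeff s)) * ι PowerSeries.X ^ (d - s.degree) *
      ∏ i, ι (u i) ^ s i)) * h2
  have hHy : PowerSeries.constantCoeff H =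
      MvPolynomial.eval y (MvPolynomial.homogeneousComponent d a) := by
    rw [MvPolynomial.homogeneousComponent_apply, map_sum, map_sum, Finset.sum_filter]
    refine Finset.sum_congr rfl fun s hs => ?_
    have hsd : s.degree ≤ d := (MvPolynomial.le_totalDegree hs).trans had
    simp only [map_mul, map_pow, map_prod, huy, PowerSeries.constantCoeff_C,
      PowerSeries.constantCoeff_X, MvPolynomial.eval_monomial, Finsupp.prod_fintype _ _
        (fun i => pow_zero (y i))]
    split_ifs with h
    · simp [h]
    · rw [zero_pow (by omega)]
      simp
  rw [← hHy]
  rcases haw with h | h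
  · rw [h, mul_zero, map_eq_zero_iff ι hιi] at hHw
    rw [hHw, map_zero]
  · rw [h, mul_one, ← map_pow] at hHw
    rw [hιi hHw, map_pow, PowerSeries.constantCoeff_X, zero_pow hd]

end Infinity

section Connected

variable {k : Type*} [Field k] {n : ℕ}

lemma esymm_isHomogeneous (j : ℕ) : (MvPolynomial.esymm (Fin n) k j).IsHomogeneous j := by
  refine MvPolynomial.IsHomogeneous.sum _ _ _ fun t ht => ?_
  have := MvPolynomial.IsHomogeneous.prod t (fun i => (MvPolynomial.X i : MvPolynomial (Fin n) k))
    (fun _ => 1) fun i _ => MvPolynomial.isHomogeneous_X k i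
  simpa [(Finset.mem_powersetCard.1 ht).2] using this

/-- A leading form in `(s₁,…,s_{n-1})` can be cancelled modulo the ideal of any fiber. -/
lemma exists_totalDegree_homogeneousComponent_sub_lt (c : ℕ → k) {d : ℕ} (hd : 0 < d)
    {f : MvPolynomial (Fin n) k} (hf : f ∈ fiberIdeal n (Pi.single 0 1)) :
    ∃ g ∈ fiberIdeal n c, (MvPolynomial.homogeneousComponent d f - g).totalDegree < d := by
  let P : Submodule k (MvPolynomial (Fin n) k) :=
    { carrier := {f | ∃ g ∈ fiberIdeal n c,
        (MvPolynomial.homogeneousComponent d f - g).totalDegree < d}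
      zero_mem' := ⟨0, zero_mem _, by simpa using hd⟩
      add_mem' := by
        rintro f₁ f₂ ⟨g₁, hg₁, h₁⟩ ⟨g₂, hg₂, h₂⟩
        refine ⟨g₁ + g₂, add_mem hg₁ hg₂, ?_⟩
        rw [map_add, add_sub_add_comm]
        exact (MvPolynomial.totalDegree_add _ _).trans_lt (max_lt h₁ h₂)
      smul_mem' := by
        rintro r f ⟨g, hg, h⟩
        refine ⟨r • g, Submodule.smul_of_tower_mem _ r hg, ?_⟩
        rw [map_smul, ← smul_sub]
        exact (MvPolynomial.totalDegree_smul_le _ _).trans_lt h }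
  change f ∈ P
  obtain ⟨h, rfl⟩ := Ideal.mem_span_range_iff_exists_fun.1 hf
  refine sum_mem fun j _ => ?_
  rw [← MvPolynomial.sum_homogeneousComponent (h j), Finset.sum_mul]
  refine sum_mem fun i _ => ?_
  have hi := MvPolynomial.homogeneousComponent_isHomogeneous i (h j)
  have hj := hi.mul (esymm_isHomogeneous (n := n) (k := k) (j + 1))
  rw [Pi.single_eq_of_ne (Nat.succ_ne_zero _), map_zero, sub_zero]
  change ∃ g ∈ fiberIdeal n c, _
  rw [MvPolynomial.homogeneousComponent_of_mem hj]
  split_ifs with hid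
  · refine ⟨_, Ideal.mul_mem_left _ (MvPolynomial.homogeneousComponent i (h j))
      (esymm_sub_C_mem_fiberIdeal c (Nat.succ_pos j) (by omega)), ?_⟩
    rw [mul_sub, sub_sub_cancel, mul_comm, ← MvPolynomial.smul_eq_C_mul]
    refine (MvPolynomial.totalDegree_smul_le _ _).trans_lt (hi.totalDegree_le.trans_lt ?_)
    omega
  · exact ⟨0, zero_mem _, by simpa using hd⟩

lemma totalDegree_sub_homogeneousComponent_lt {a : MvPolynomial (Fin n) k} {d : ℕ} (hd : 0 < d)
    (had : a.totalDegree ≤ d) :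
    (a - MvPolynomial.homogeneousComponent d a).totalDegree < d := by
  rw [MvPolynomial.totalDegree, Finset.sup_lt_iff hd]
  intro s hs
  rw [MvPolynomial.mem_support_iff, MvPolynomial.coeff_sub,
    MvPolynomial.coeff_homogeneousComponent] at hs
  have hsd : s.degree ≠ d := by
    intro h
    simp [h] at hs
  rw [if_neg hsd, sub_zero] at hs
  exact lt_of_le_of_ne ((MvPolynomial.le_totalDegree (MvPolynomial.mem_support_iff.2 hs)).trans had)
    hsd

/-- An element of the coordinate ring of a fiber that is idempotent modulo nilpotents is
a constant. -/
lemma exists_sub_C_mem_fiberIdeal [IsAlgClosed k] [CharZero k] (hn : n ≠ 0) {c : ℕ → k}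
    (hc : c 0 = 1) (a : MvPolynomial (Fin n) k)
    (ha : a * (1 - a) ∈ (fiberIdeal n c).radical) :
    ∃ r, a - MvPolynomial.C r ∈ fiberIdeal n c := by
  induction h : a.totalDegree using Nat.strong_induction_on generalizing a with
  | _ d ih =>
  rcases Nat.eq_zero_or_pos d with rfl | hd
  · rw [MvPolynomial.totalDegree_eq_zero_iff_eq_C.1 h]
    exact ⟨_, by rw [sub_self]; exact zero_mem _⟩
  have hlead : MvPolynomial.homogeneousComponent d a ∈ fiberIdeal n (Pi.single 0 1) := by
    refine mem_fiberIdeal_of_eval_eq_zero hn (by simp) fun y hy => ?_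
    refine eval_homogeneousComponent_eq_zero hn (fun j h0 hj => ?_) hc ha hd.ne' h.le
    rw [hy j h0 hj, Pi.single_eq_of_ne h0.ne']
  obtain ⟨g, hg, hlt⟩ := exists_totalDegree_homogeneousComponent_sub_lt c hd hlead
  rw [MvPolynomial.homogeneousComponent_eq_self
    (MvPolynomial.homogeneousComponent_isHomogeneous d a)] at hlt
  have hdeg : (a - g).totalDegree < d := by
    rw [← sub_add_sub_cancel a (MvPolynomial.homogeneousComponent d a) g]
    exact (MvPolynomial.totalDegree_add _ _).trans_lt
      (max_lt (totalDegree_sub_homogeneousComponent_lt hd h.le) hlt)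
  obtain ⟨r, hr⟩ := ih _ hdeg (a - g) (by
    have hg' := Ideal.le_radical hg
    have : (a - g) * (1 - (a - g)) = a * (1 - a) + g * (2 * a - 1 - g) := by ring
    rw [this]
    exact add_mem ha (Ideal.mul_mem_right _ _ hg')) rfl
  refine ⟨r, ?_⟩
  have := add_mem hr hg
  rwa [sub_right_comm, sub_add_cancel] at this

end Connected

section Local

/-- In a Noetherian local ring whose maximal ideal is principal modulo `I`, every nonmaximal prime
containing `I` equals `I`. -/
lemma le_of_isPrime_of_maximalIdeal_le_span_singleton_sup {S : Type*} [CommRing S] [IsLocalRing S]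
    [IsNoetherianRing S] {I P : Ideal S} {a : S} (ham : a ∈ IsLocalRing.maximalIdeal S)
    (ha : IsLocalRing.maximalIdeal S ≤ Ideal.span {a} ⊔ I) [hP : P.IsPrime] (hIP : I ≤ P)
    (hPm : P ≠ IsLocalRing.maximalIdeal S) : P ≤ I := by
  have hPle : P ≤ IsLocalRing.maximalIdeal S := IsLocalRing.le_maximalIdeal hP.ne_top
  have haP : a ∉ P := fun h => hPm <| le_antisymm hPle <|
    ha.trans (sup_le ((Ideal.span_singleton_le_iff_mem _).2 h) hIP)
  refine Submodule.le_of_le_smul_of_le_jacobson_bot (I := IsLocalRing.maximalIdeal S)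
    (IsNoetherian.noetherian P) (IsLocalRing.maximalIdeal_le_jacobson _) fun f hf => ?_
  obtain ⟨b, hb, i, hi, rfl⟩ := Submodule.mem_sup.1 (ha (hPle hf))
  obtain ⟨g, rfl⟩ := Ideal.mem_span_singleton.1 hb
  have hg : g ∈ P := ((hP.mem_or_mem ((Ideal.add_mem_iff_left _ (hIP hi)).1 hf))).resolve_left haP
  rw [add_comm]
  exact Submodule.add_mem_sup hi (Submodule.smul_mem_smul ham hg)

/-- Two tuples with the same `s₁,…,s_{n-1}` have differences generating a principal ideal,
provided that at most two entries of the second fail to be simple. -/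
lemma dvd_sub_of_elemSymm_eq {T : Type*} [CommRing T] {n : ℕ} (hn : 2 ≤ n) {ξ a : Fin n → T}
    (h : ∀ j, 0 < j → j < n → elemSymm ξ j = elemSymm a j) {p q : Fin n}
    (hunit : ∀ i, i ≠ p → i ≠ q → ∀ j, j ≠ i → IsUnit (ξ i - a j)) (i : Fin n) :
    ξ p - a p ∣ ξ i - a i := by
  classical
  have hconst : ∃ u : T, ∏ j, (X - C (a j)) = ∏ j, (X - C (ξ j)) + C u := by
    refine ⟨(-1) ^ n * elemSymm a n - (-1) ^ n * elemSymm ξ n, ?_⟩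
    rw [prod_X_sub_C_eq_of_elemSymm (elemSymm_zero a) h,
      prod_X_sub_C_eq_of_elemSymm (elemSymm_zero a) (fun j _ _ => rfl), vietaPoly_eq_add,
      vietaPoly_eq_add _ (elemSymm ξ n), C_sub]
    ring
  obtain ⟨u, hu⟩ := hconst
  have hev (i : Fin n) : (ξ i - a i) * ∏ j ∈ Finset.univ.erase i, (ξ i - a j) = u := by
    have := congrArg (eval (ξ i)) hu
    rw [eval_add, eval_prod, eval_prod,
      Finset.prod_eq_zero (i := i) (f := fun j => eval (ξ i) (X - C (ξ j))) (Finset.mem_univ i)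
      (by simp), eval_C, zero_add, ← Finset.mul_prod_erase _ _ (Finset.mem_univ i)] at this
    simpa using this
  have hpu : ξ p - a p ∣ u := ⟨_, (hev p).symm⟩
  have hsimple (i : Fin n) (hip : i ≠ p) (hiq : i ≠ q) : ξ p - a p ∣ ξ i - a i := by
    have hU : IsUnit (∏ j ∈ Finset.univ.erase i, (ξ i - a j)) :=
      IsUnit.prod_iff.2 fun j hj => hunit i hip hiq j (Finset.ne_of_mem_erase hj)
    rw [← hU.dvd_mul_right, hev]
    exact hpu
  by_cases hip : i = p
  · rw [hip]
  by_cases hiq : i = q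
  · have hsum : ∑ j, (ξ j - a j) = 0 := by
      rw [Finset.sum_sub_distrib, ← elemSymm_one, ← elemSymm_one, h 1 one_pos (by omega), sub_self]
    rw [← Finset.add_sum_erase _ _ (Finset.mem_univ i)] at hsum
    rw [eq_neg_of_add_eq_zero_left hsum, dvd_neg]
    refine Finset.dvd_sum fun j hj => ?_
    by_cases hjp : j = p
    · rw [hjp]
    · exact hsimple j hjp (hiq ▸ Finset.ne_of_mem_erase hj)
  · exact hsimple i hip hiq

end Local

section LocalFiber

variable {k : Type*} [Field k] {n : ℕ}

/-- At a point of a fiber with at most one coincidence of coordinates, the local ring of the fiber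
has principal maximal ideal. -/
lemma maximalIdeal_le_span_singleton_sup_map (hn : 2 ≤ n) {c : ℕ → k}
    {x : Fin n → k} (h : ∀ j, 0 < j → j < n → elemSymm x j = c j) {p q : Fin n}
    (hpq : ∀ i, i ≠ p → i ≠ q → ∀ j, j ≠ i → x i ≠ x j)
    {S : Type*} [CommRing S] [Algebra (MvPolynomial (Fin n) k) S] [IsLocalRing S]
    [(RingHom.ker (MvPolynomial.eval x)).IsPrime]
    [IsLocalization.AtPrime S (RingHom.ker (MvPolynomial.eval x))] :
    IsLocalRing.maximalIdeal S ≤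
      Ideal.span {algebraMap (MvPolynomial (Fin n) k) S (MvPolynomial.X p - MvPolynomial.C (x p))} ⊔
        (fiberIdeal n c).map (algebraMap (MvPolynomial (Fin n) k) S) := by
  set J := Ideal.span
      {algebraMap (MvPolynomial (Fin n) k) S (MvPolynomial.X p - MvPolynomial.C (x p))} ⊔
    (fiberIdeal n c).map (algebraMap (MvPolynomial (Fin n) k) S) with hJ
  let I' := (fiberIdeal n c).map (algebraMap (MvPolynomial (Fin n) k) S)
  let ρ : MvPolynomial (Fin n) k →+* S ⧸ I' := (Ideal.Quotient.mk I').comp (algebraMap _ S)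
  have hρ {f} (hf : f ∈ fiberIdeal n c) : ρ f = 0 :=
    Ideal.Quotient.eq_zero_iff_mem.2 (Ideal.mem_map_of_mem _ hf)
  have hdvd (i : Fin n) : ρ (MvPolynomial.X p) - ρ (MvPolynomial.C (x p)) ∣
      ρ (MvPolynomial.X i) - ρ (MvPolynomial.C (x i)) := by
    refine dvd_sub_of_elemSymm_eq hn (ξ := fun i => ρ (MvPolynomial.X i))
      (a := fun i => ρ (MvPolynomial.C (x i))) (fun j h0 hj => ?_) (p := p) (q := q)
      (fun i hip hiq j hji => ?_) i
    · have h1 := map_elemSymm (ρ.comp MvPolynomial.C) x j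
      have h2 := hρ (esymm_sub_C_mem_fiberIdeal c h0 hj)
      rw [map_sub, sub_eq_zero] at h2
      rw [← map_elemSymm ρ, ← aeval_esymm_eq_elemSymm (R := k), MvPolynomial.aeval_X_left_apply,
        h2, ← h j h0 hj]
      exact h1
    · rw [← map_sub]
      refine IsUnit.map (Ideal.Quotient.mk I') ?_
      refine IsLocalization.map_units S (M := (RingHom.ker (MvPolynomial.eval x)).primeCompl)
        ⟨_, ?_⟩
      simpa [Ideal.primeCompl, sub_eq_zero] using hpq i hip hiq j hji
  have hXJ (i : Fin n) : algebraMap _ S (MvPolynomial.X i - MvPolynomial.C (x i)) ∈ J := by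
    obtain ⟨t, ht⟩ := hdvd i
    obtain ⟨t, rfl⟩ := Ideal.Quotient.mk_surjective t
    rw [← map_sub, ← map_sub] at ht
    have := Ideal.Quotient.eq.1 ht
    exact (Submodule.sub_mem_iff_left J (Ideal.mem_sup_left
      (Ideal.mul_mem_right _ _ (Ideal.mem_span_singleton_self _)))).1 (Ideal.mem_sup_right this)
  have hhom : (Ideal.Quotient.mk J).comp (algebraMap (MvPolynomial (Fin n) k) S) =
      ((Ideal.Quotient.mk J).comp (algebraMap (MvPolynomial (Fin n) k) S)).comp
        (MvPolynomial.C.comp (MvPolynomial.eval x)) := by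
    refine MvPolynomial.ringHom_ext (fun r => by simp) fun i => ?_
    have := Ideal.Quotient.eq_zero_iff_mem.2 (hXJ i)
    rw [map_sub, map_sub, sub_eq_zero] at this
    simpa using this
  rw [← IsLocalization.AtPrime.map_eq_maximalIdeal (RingHom.ker (MvPolynomial.eval x)) S,
    Ideal.map_le_iff_le_comap]
  intro f hf
  have := RingHom.congr_fun hhom f
  rw [Ideal.mem_comap, ← Ideal.Quotient.eq_zero_iff_mem]
  simpa [(RingHom.mem_ker).1 hf] using this

/-- At a point with at most one coincidence of coordinates, a fiber has only one branch. -/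
lemma le_of_isPrime_of_lt_ker_eval (hn : 2 ≤ n) {c : ℕ → k}
    {x : Fin n → k} (h : ∀ j, 0 < j → j < n → elemSymm x j = c j) {p q : Fin n}
    (hpq : ∀ i, i ≠ p → i ≠ q → ∀ j, j ≠ i → x i ≠ x j)
    {P Q : Ideal (MvPolynomial (Fin n) k)} [hP : P.IsPrime] [hQ : Q.IsPrime]
    (hIP : fiberIdeal n c ≤ P) (hIQ : fiberIdeal n c ≤ Q)
    (hPx : P < RingHom.ker (MvPolynomial.eval x)) (hQx : Q ≤ RingHom.ker (MvPolynomial.eval x)) :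
    P ≤ Q := by
  set M := RingHom.ker (MvPolynomial.eval x)
  have hM : M.IsPrime := RingHom.ker_isPrime _
  let S := Localization.AtPrime M
  have hdisj {P : Ideal (MvPolynomial (Fin n) k)} (h : P ≤ M) :
      Disjoint (M.primeCompl : Set (MvPolynomial (Fin n) k)) P :=
    Set.disjoint_left.2 fun _ ha hb => ha (h hb)
  have hcomap {P : Ideal (MvPolynomial (Fin n) k)} (hP : P.IsPrime) (h : P ≤ M) :
      (P.map (algebraMap _ S)).comap (algebraMap _ S) = P :=
    IsLocalization.under_map_of_isPrime_disjoint M.primeCompl S hP (hdisj h)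
  have : (P.map (algebraMap _ S)).IsPrime :=
    IsLocalization.isPrime_of_isPrime_disjoint M.primeCompl S P hP (hdisj hPx.le)
  have hne : P.map (algebraMap _ S) ≠ IsLocalRing.maximalIdeal S := by
    rw [← IsLocalization.AtPrime.map_eq_maximalIdeal M S]
    intro h
    rw [← hcomap hP hPx.le, h, hcomap hM le_rfl] at hPx
    exact hPx.false
  have hNoeth : IsNoetherianRing S := IsLocalization.isNoetherianRing M.primeCompl S inferInstance
  have key := le_of_isPrime_of_maximalIdeal_le_span_singleton_sup (S := S) (by
    rw [← IsLocalization.AtPrime.map_eq_maximalIdeal M S]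
    exact Ideal.mem_map_of_mem _ (by simp [M]))
    (maximalIdeal_le_span_singleton_sup_map hn h hpq) (Ideal.map_mono hIP) hne
  rw [← hcomap hP hPx.le, ← hcomap hQ hQx]
  exact Ideal.comap_mono (key.trans (Ideal.map_mono hIQ))

end LocalFiber

section Genericity

variable {k : Type*} [Field k] {n : ℕ}

/-- A tuple of length `n` with at least `n - 1` values has at most one coincidence, otherwise it
factors through `Fin (n - 2)`. -/
lemma exists_eq_comp_or_exists_forall_ne {α : Type*} (hn : 3 ≤ n) (x : Fin n → α) :
    (∃ (ψ : Fin n → Fin (n - 2)) (y : Fin (n - 2) → α), x = y ∘ ψ) ∨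
      ∃ p q, ∀ i, i ≠ p → i ≠ q → ∀ j, j ≠ i → x i ≠ x j := by
  classical
  by_cases hcard : (Finset.univ.image x).card ≤ n - 2
  · left
    let s := Finset.univ.image x
    have hmem (i : Fin n) : x i ∈ s := Finset.mem_image_of_mem _ (Finset.mem_univ i)
    let e : Fin s.card ↪ Fin (n - 2) := Fin.castLEEmb hcard
    have : Nonempty (Fin s.card) := ⟨s.equivFin ⟨x ⟨0, by omega⟩, hmem _⟩⟩
    refine ⟨fun i => e (s.equivFin ⟨x i, hmem i⟩),
      fun j => s.equivFin.symm (Function.invFun e j), ?_⟩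
    funext i
    simp [Function.leftInverse_invFun e.injective _]
  · right
    by_cases hinj : Function.Injective x
    · exact ⟨⟨0, by omega⟩, ⟨0, by omega⟩, fun i _ _ j hj h => hj (hinj h).symm⟩
    · obtain ⟨p, q, hpq, hne⟩ : ∃ p q, x p = x q ∧ p ≠ q := by
        simpa [Function.Injective] using hinj
      refine ⟨p, q, ?_⟩
      have himage : (Finset.univ.erase q).image x = Finset.univ.image x := by
        refine (Finset.image_subset_image (Finset.erase_subset _ _)).antisymm ?_
        rw [Finset.image_subset_iff]
        intro i _
        by_cases hi : i = q
        · rw [hi, ← hpq]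
          exact Finset.mem_image_of_mem _ (Finset.mem_erase.2 ⟨hne, Finset.mem_univ p⟩)
        · exact Finset.mem_image_of_mem _ (Finset.mem_erase.2 ⟨hi, Finset.mem_univ i⟩)
      have hinj' : Set.InjOn x (Finset.univ.erase q : Finset (Fin n)) := by
        refine Finset.injOn_of_card_image_eq (le_antisymm Finset.card_image_le ?_)
        rw [himage, Finset.card_erase_of_mem (Finset.mem_univ q), Finset.card_univ,
          Fintype.card_fin]
        omega
      intro i hip hiq j hji h
      by_cases hjq : j = q
      · exact hip (hinj' (by simpa using hiq) (by simpa using hne) (by rw [h, hjq, hpq]))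
      · exact hji (hinj' (by simpa using hjq) (by simpa using hiq) h.symm)

/-- The functions `s₁,…,s_{n-1}` are algebraically dependent on tuples with few values. -/
lemma exists_ne_zero_eval_elemSymm_comp_eq_zero {m : ℕ} (hm : m < n - 1) (ψ : Fin n → Fin m) :
    ∃ h : MvPolynomial (Fin (n - 1)) k, h ≠ 0 ∧
      ∀ y : Fin m → k,
        MvPolynomial.eval (fun j : Fin (n - 1) => elemSymm (y ∘ ψ) ((j : ℕ) + 1)) h = 0 := by
  let f : Fin (n - 1) → MvPolynomial (Fin m) k := fun j =>
    elemSymm (fun i => MvPolynomial.X (ψ i)) ((j : ℕ) + 1)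
  have hdep : ¬ AlgebraicIndependent k f := by
    intro hf
    have := hf.lift_cardinalMk_le_trdeg
    rw [MvPolynomial.trdeg_of_isDomain] at this
    simp only [Cardinal.mk_fin, Cardinal.lift_natCast, Nat.cast_le] at this
    omega
  rw [algebraicIndependent_iff] at hdep
  push Not at hdep
  obtain ⟨h, h0, hne⟩ := hdep
  refine ⟨h, hne, fun y => ?_⟩
  have := congrArg (MvPolynomial.aeval y) h0
  rw [map_zero, ← AlgHom.comp_apply, MvPolynomial.comp_aeval, MvPolynomial.aeval_eq_eval] at this
  convert! this using 3
  funext j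
  have := map_elemSymm (MvPolynomial.aeval (R := k) y : MvPolynomial (Fin m) k →+* k)
    (fun i => MvPolynomial.X (ψ i)) ((j : ℕ) + 1)
  simpa [Function.comp_def] using this.symm

end Genericity

section Irreducible

variable {k : Type*} [Field k] {n : ℕ}

/-- An ideal with finitely many pairwise comaximal minimal primes, whose quotient has only trivial
idempotents up to nilpotents, has prime radical. -/
lemma radical_isPrime_of_minimalPrimes {R : Type*} [CommRing R] [IsNoetherianRing R] {I : Ideal R}
    (hI : I ≠ ⊤) (hcop : I.minimalPrimes.Pairwise fun P Q => P ⊔ Q = ⊤)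
    (hidem : ∀ a, a * (1 - a) ∈ I.radical → a ∈ I ∨ 1 - a ∈ I) : I.radical.IsPrime := by
  classical
  obtain ⟨P, hP⟩ : I.minimalPrimes.Nonempty :=
    Set.nonempty_coe_sort.1 (Ideal.nonempty_minimalPrimes hI)
  have hfin := Ideal.finite_minimalPrimes_of_isNoetherianRing R I
  suffices h : I.radical = P by
    rw [h]
    exact hP.1.1
  rw [← Ideal.sInf_minimalPrimes]
  refine le_antisymm (sInf_le hP) (le_sInf fun Q hQ => ?_)
  by_contra hPQ
  have hne : P ≠ Q := fun h => hPQ h.le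
  have htop : P ⊔ ⨅ Q' ∈ hfin.toFinset.erase P, Q' = ⊤ := by
    refine Ideal.sup_iInf_eq_top fun Q' hQ' => ?_
    rw [Finset.mem_erase, Set.Finite.mem_toFinset] at hQ'
    exact hcop hP hQ'.2 hQ'.1.symm
  obtain ⟨a, ha, b, hb, hab⟩ := Submodule.mem_sup.1 ((Ideal.eq_top_iff_one _).1 htop)
  have hb' {Q' : Ideal R} (hQ' : Q' ∈ I.minimalPrimes) (h : Q' ≠ P) : b ∈ Q' := by
    simp only [Submodule.mem_iInf] at hb
    exact hb Q' (by simp [h, hQ'])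
  obtain rfl : b = 1 - a := eq_sub_of_add_eq' hab
  rcases hidem a (by
    rw [← Ideal.sInf_minimalPrimes, Submodule.mem_sInf]
    intro Q' hQ'
    by_cases h : Q' = P
    · rw [h]
      exact Ideal.mul_mem_right _ _ ha
    · exact Ideal.mul_mem_left _ _ (hb' hQ' h)) with h | h
  · refine hQ.1.1.ne_top ((Ideal.eq_top_iff_one _).2 ?_)
    rw [← hab]
    exact add_mem (hQ.1.2 h) (hb' hQ hne.symm)
  · refine hP.1.1.ne_top ((Ideal.eq_top_iff_one _).2 ?_)
    rw [← hab]
    exact add_mem ha (hP.1.2 h)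

lemma exists_elemSymm_eq [IsAlgClosed k] {c : ℕ → k} (hc : c 0 = 1) :
    ∃ x : Fin n → k, ∀ j, 0 < j → j < n → elemSymm x j = c j := by
  obtain ⟨x, hx⟩ := exists_vietaPoly_eq_prod (n := n) hc
  exact ⟨x, fun j _ hj => elemSymm_of_vietaPoly_eq_prod hx hj.le⟩

lemma mem_or_one_sub_mem_fiberIdeal [IsAlgClosed k] [CharZero k] (hn : n ≠ 0) {c : ℕ → k}
    (hc : c 0 = 1) {a : MvPolynomial (Fin n) k} (ha : a * (1 - a) ∈ (fiberIdeal n c).radical) :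
    a ∈ fiberIdeal n c ∨ 1 - a ∈ fiberIdeal n c := by
  obtain ⟨r, hr⟩ := exists_sub_C_mem_fiberIdeal hn hc a ha
  obtain ⟨x, hx⟩ := exists_elemSymm_eq (n := n) hc
  obtain ⟨m, hm⟩ := ha
  have h1 := eval_eq_zero_of_mem_fiberIdeal hx hm
  have h2 := eval_eq_zero_of_mem_fiberIdeal hx hr
  rw [map_sub, MvPolynomial.eval_C, sub_eq_zero] at h2
  simp only [map_pow, map_mul, map_sub, map_one, h2] at h1
  rcases mul_eq_zero.1 (eq_zero_of_pow_eq_zero h1) with rfl | h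
  · left
    simpa using hr
  · right
    rw [← sub_eq_zero.1 h, MvPolynomial.C_1] at hr
    simpa using neg_mem hr

/-- A fiber all of whose points have at most one coincidence of coordinates is irreducible. -/
lemma radical_fiberIdeal_isPrime [IsAlgClosed k] [CharZero k] (hn : 2 ≤ n) {c : ℕ → k}
    (hc : c 0 = 1) (h : ∀ x : Fin n → k, (∀ j, 0 < j → j < n → elemSymm x j = c j) →
      ∃ p q, ∀ i, i ≠ p → i ≠ q → ∀ j, j ≠ i → x i ≠ x j) :
    (fiberIdeal n c).radical.IsPrime := by
  refine radical_isPrime_of_minimalPrimes ?_ (fun P hP Q hQ hPQ => ?_)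
    fun a ha => mem_or_one_sub_mem_fiberIdeal (by omega) hc ha
  · rw [Ideal.ne_top_iff_one]
    intro h1
    obtain ⟨x, hx⟩ := exists_elemSymm_eq (n := n) hc
    simpa using eval_eq_zero_of_mem_fiberIdeal hx h1
  · by_contra htop
    obtain ⟨M, hM, hle⟩ := Ideal.exists_le_maximal _ htop
    obtain ⟨x, rfl⟩ := MvPolynomial.isMaximal_iff_eq_vanishingIdeal_singleton.1 hM
    have hker : MvPolynomial.vanishingIdeal k {x} = RingHom.ker (MvPolynomial.eval x) := by
      ext f
      rw [MvPolynomial.mem_vanishingIdeal_singleton_iff, RingHom.mem_ker,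
        MvPolynomial.aeval_eq_eval]
    rw [hker, sup_le_iff] at hle
    have hx (j : ℕ) (h0 : 0 < j) (hj : j < n) : elemSymm x j = c j := by
      have := hle.1 (hP.1.2 (esymm_sub_C_mem_fiberIdeal c h0 hj))
      rwa [RingHom.mem_ker, map_sub, eval_esymm_eq_elemSymm, MvPolynomial.eval_C,
        sub_eq_zero] at this
    obtain ⟨p, q, hpq⟩ := h x hx
    have := hP.1.1
    have := hQ.1.1
    rcases hle.1.eq_or_lt with hPM | hPM
    · exact hPQ (le_antisymm (hP.2 hQ.1 (hPM ▸ hle.2)) (hPM ▸ hle.2))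
    · have hPQ' := le_of_isPrime_of_lt_ker_eval hn hx hpq hP.1.2 hQ.1.2 hPM hle.2
      exact hPQ (le_antisymm hPQ' (hQ.2 hP.1 hPQ'))

end Irreducible

/-- For `n ≥ 5`, the general fiber of `φ = (s₁,…,s_{n-1}) : 𝔸ⁿ → 𝔸^{n-1}` is
irreducible: there is a nonzero polynomial `h` on `𝔸^{n-1}` such that for every
point `c` with `h(c) ≠ 0`, the radical of the ideal `(s₁ - c₁, …, s_{n-1} - c_{n-1})`
is prime. -/
theorem general_fiber_of_elementary_symmetric_irreducible
    (k : Type) [Field k] [IsAlgClosed k] [CharZero k]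
    (n : ℕ) (hn : 5 ≤ n) :
    ∃ h : MvPolynomial (Fin (n - 1)) k, h ≠ 0 ∧
      ∀ c : Fin (n - 1) → k, MvPolynomial.eval c h ≠ 0 →
        (Ideal.span (Set.range fun j : Fin (n - 1) =>
            MvPolynomial.esymm (Fin n) k ((j : ℕ) + 1)
              - MvPolynomial.C (c j))).radical.IsPrime := by
  have hdep (ψ : Fin n → Fin (n - 2)) :=
    exists_ne_zero_eval_elemSymm_comp_eq_zero (k := k) (show n - 2 < n - 1 by omega) ψ
  choose h hne hzero using hdep
  refine ⟨∏ ψ, h ψ, Finset.prod_ne_zero_iff.2 fun ψ _ => hne ψ, fun c hc => ?_⟩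
  let c' : ℕ → k := fun m =>
    if m = 0 then 1 else if hm : m - 1 < n - 1 then c ⟨m - 1, hm⟩ else 0
  have hc' (j : Fin (n - 1)) : c' (j + 1) = c j := by simp [c']
  suffices (fiberIdeal n c').radical.IsPrime by
    simpa only [fiberIdeal, hc'] using this
  refine radical_fiberIdeal_isPrime (by omega) (by simp [c']) fun x hx => ?_
  refine (exists_eq_comp_or_exists_forall_ne (by omega) x).resolve_left ?_
  rintro ⟨ψ, y, rfl⟩
  refine hc ?_
  rw [map_prod]
  refine Finset.prod_eq_zero (Finset.mem_univ ψ) ?_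
  rw [← hzero ψ y]
  congr 2
  funext j
  rw [hx _ (Nat.succ_pos _) (by omega), hc']
end

section
/- Let k be a field of characteristic zero, n ≥ 1, and let a = (a₁,…,aₙ) ∈ kⁿ be a point whose coordinates take at least n−1 distinct values (i.e. the image of the function i ↦ a_i has cardinality at least n−1). Then the (n−1)×n matrix M with entries M_{j,i} = j·a_iʲ⁻¹ for 1 ≤ j ≤ n−1 and 1 ≤ i ≤ n (the Jacobian matrix of the power sums p₁,…,p_{n−1} evaluated at a) has rank n−1. -/
/-- If `v` takes at least `m` distinct values, then `m` indices can be chosen at which the values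
of `v` are pairwise distinct. -/
theorem exists_injective_comp_of_le_ncard_range {ι α : Type*} [Finite ι] {m : ℕ} (v : ι → α)
    (hv : m ≤ (Set.range v).ncard) : ∃ g : Fin m → ι, Function.Injective (v ∘ g) := by
  have := Fintype.ofFinite (Set.range v)
  rw [← Nat.card_coe_set_eq, Nat.card_eq_fintype_card] at hv
  obtain ⟨e⟩ : Nonempty (Fin m ↪ Set.range v) :=
    Function.Embedding.nonempty_of_card_le (by simpa using hv)
  choose g hg using fun j => (e j).2
  refine ⟨g, fun x y hxy => e.injective (Subtype.ext ?_)⟩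
  simpa only [Function.comp_apply, hg] using hxy

/-- If the coordinates of `a ∈ kⁿ` take at least `n - 1` distinct values, then the
Jacobian matrix of the power sums `p₁,…,p_{n-1}` at `a`, i.e. the `(n-1) × n` matrix
with entries `M_{j,i} = j · a_i^{j-1}`, has rank `n - 1`. -/
theorem jacobian_of_power_sums_rank
    (k : Type) [Field k] [CharZero k] (n : ℕ) (hn : 1 ≤ n)
    (a : Fin n → k) (ha : n - 1 ≤ (Set.range a).ncard) :
    (Matrix.of fun (j : Fin (n - 1)) (i : Fin n) =>
        (((j : ℕ) + 1 : ℕ) : k) * a i ^ (j : ℕ)).rank = n - 1 := by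
  obtain ⟨g, hg⟩ := exists_injective_comp_of_le_ncard_range a ha
  refine (LinearIndependent.rank_matrix ?_).trans (Fintype.card_fin _)
  refine Fintype.linearIndependent_iff.2 fun c hc j => ?_
  have hzero := Matrix.eq_zero_of_forall_index_sum_mul_pow_eq_zero
    (v := fun j : Fin (n - 1) => c j * (((j : ℕ) + 1 : ℕ) : k)) hg fun i => by
      simpa [Finset.sum_apply, Matrix.row, mul_assoc] using congrFun hc (g i)
  exact (mul_eq_zero.1 (congrFun hzero j)).resolve_right (Nat.cast_ne_zero.2 (Nat.succ_ne_zero _))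
end

section
/- Let k be a field of characteristic zero and m ≥ 1. In the polynomial ring k[x₀,…,x_{m−1}] define, for 1 ≤ j ≤ m, the polynomials q_j := (x₀ʲ + x₁ʲ + ⋯ + x_{m−1}ʲ) + x₀ʲ (the j-th power sum in which the variable x₀ is counted twice). Then the family q₁, q₂, …, q_m is algebraically independent over k. -/
namespace MvPolynomial

variable {σ ι R : Type*}

/-- The chain rule for a derivation applied to a polynomial expression. -/
theorem derivation_aeval [CommSemiring R] [Fintype ι] {A : Type*} [CommSemiring A] [Algebra R A]
    (D : Derivation R A A) (q : ι → A) (P : MvPolynomial ι R) :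
    D (aeval q P) = ∑ j, aeval q (pderiv j P) * D (q j) := by
  classical
  induction P using MvPolynomial.induction_on with
  | C a => simp
  | add P Q hP hQ => simp [hP, hQ, add_mul, Finset.sum_add_distrib]
  | mul_X P i hP =>
    simp only [map_mul, aeval_X, Derivation.leibniz, smul_eq_mul, pderiv_X, map_add, add_mul,
      Finset.sum_add_distrib, hP, Finset.mul_sum]
    congr 1
    · rw [Finset.sum_eq_single i (fun j _ hj => by simp [hj.symm]) (by simp)]
      simp
    · exact Finset.sum_congr rfl fun j _ => by ring

theorem totalDegree_pderiv_le [CommSemiring R] (i : σ) (P : MvPolynomial σ R) :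
    (pderiv i P).totalDegree ≤ P.totalDegree - 1 := by
  refine Finset.sup_le fun s hs => ?_
  have hs' : s + Finsupp.single i 1 ∈ P.support := by
    rw [mem_support_iff, coeff_pderiv] at hs
    exact mem_support_iff.2 (left_ne_zero_of_mul hs)
  have h := le_totalDegree hs'
  rw [Finsupp.sum_add_index' (fun _ => rfl) (fun _ _ _ => rfl), Finsupp.sum_single_index rfl] at h
  exact Nat.le_sub_of_add_le h

theorem eq_C_of_forall_pderiv_eq_zero [CommSemiring R] [NoZeroDivisors R] [CharZero R]
    {P : MvPolynomial σ R} (h : ∀ i, pderiv i P = 0) : P = C (coeff 0 P) := by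
  classical
  ext s
  rw [coeff_C]
  split_ifs with hs
  · rw [hs]
  obtain ⟨i, hi⟩ := Finsupp.ne_iff.1 (Ne.symm hs)
  have hle : Finsupp.single i 1 ≤ s := Finsupp.single_le_iff.2 (Nat.one_le_iff_ne_zero.2 hi)
  have hc := coeff_pderiv P (s - Finsupp.single i 1) (i := i)
  rw [h i, coeff_zero, tsub_add_cancel_of_le hle] at hc
  exact (mul_eq_zero.1 hc.symm).resolve_right (Nat.cast_add_one_ne_zero _)

/-- The Jacobian criterion: in characteristic zero, polynomials whose gradients are linearly
independent are algebraically independent. -/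
theorem algebraicIndependent_of_pderiv [CommRing R] [IsDomain R] [CharZero R] [Fintype ι]
    (q : ι → MvPolynomial σ R)
    (h : ∀ v : ι → MvPolynomial σ R, (∀ i, ∑ j, v j * pderiv i (q j) = 0) → v = 0) :
    AlgebraicIndependent R q := by
  have of_C : ∀ P : MvPolynomial ι R, P = C (coeff 0 P) → aeval q P = 0 → P = 0 := by
    intro P hP h0
    rw [hP, aeval_C, algebraMap_eq, C_eq_zero] at h0
    rw [hP, h0, C_0]
  have key : ∀ (n : ℕ) (P : MvPolynomial ι R), P.totalDegree ≤ n → aeval q P = 0 → P = 0 := by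
    intro n
    induction n with
    | zero =>
      intro P hP
      exact of_C P (totalDegree_eq_zero_iff_eq_C.1 (Nat.le_zero.1 hP))
    | succ n ih =>
      intro P hP h0
      have hv := h (fun j => aeval q (pderiv j P)) fun i => by
        rw [← derivation_aeval, h0, map_zero]
      refine of_C P (eq_C_of_forall_pderiv_eq_zero fun j => ih _ ?_ (congrFun hv j)) h0
      exact (totalDegree_pderiv_le j P).trans (Nat.sub_le_of_le_add hP)
  exact algebraicIndependent_iff.2 fun P => key _ P le_rfl

end MvPolynomial

/-- In characteristic zero, the polynomials `q_j = (x₀ʲ + ⋯ + x_{m-1}ʲ) + x₀ʲ`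
(the power sums in which the variable `x₀` is counted twice), for `j = 1,…,m`, are
algebraically independent over `k`. -/
theorem power_sums_with_doubled_variable_algebraicIndependent
    (k : Type) [Field k] [CharZero k] (m : ℕ) (hm : 1 ≤ m) :
    AlgebraicIndependent k (fun j : Fin m =>
      MvPolynomial.psum (Fin m) k ((j : ℕ) + 1)
        + MvPolynomial.X (⟨0, hm⟩ : Fin m) ^ ((j : ℕ) + 1)) := by
  refine MvPolynomial.algebraicIndependent_of_pderiv _ fun v hv => ?_
  have hpderiv : ∀ i j : Fin m, MvPolynomial.pderiv i (MvPolynomial.psum (Fin m) k ((j : ℕ) + 1)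
      + MvPolynomial.X (⟨0, hm⟩ : Fin m) ^ ((j : ℕ) + 1)) =
      (1 + if i = ⟨0, hm⟩ then 1 else 0) *
        ((((j : ℕ) : MvPolynomial (Fin m) k) + 1) * MvPolynomial.X i ^ (j : ℕ)) := by
    intro i j
    have hpow : ∀ l : Fin m,
        MvPolynomial.pderiv i (MvPolynomial.X l ^ ((j : ℕ) + 1) : MvPolynomial (Fin m) k) =
          if i = l then (((j : ℕ) : MvPolynomial (Fin m) k) + 1) * MvPolynomial.X i ^ (j : ℕ)
          else 0 := by
      intro l
      rw [MvPolynomial.pderiv_pow]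
      split_ifs with hl
      · subst hl
        simp
      · simp [MvPolynomial.pderiv_X_of_ne (Ne.symm hl)]
    simp only [MvPolynomial.psum, map_add, map_sum, hpow, Finset.sum_ite_eq, Finset.mem_univ,
      if_true]
    split_ifs <;> ring
  have hw := Matrix.eq_zero_of_forall_index_sum_mul_pow_eq_zero
    (f := fun i : Fin m => (MvPolynomial.X i : MvPolynomial (Fin m) k))
    (v := fun j => v j * (((j : ℕ) : MvPolynomial (Fin m) k) + 1))
    MvPolynomial.X_injective fun i => by
      have hi := hv i
      simp only [hpderiv] at hi
      have hc : (1 + if i = ⟨0, hm⟩ then 1 else 0 : MvPolynomial (Fin m) k) ≠ 0 := by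
        split_ifs
        · rw [one_add_one_eq_two]
          exact two_ne_zero
        · simp
      refine (mul_eq_zero.1 ?_).resolve_left hc
      rw [Finset.mul_sum]
      refine Eq.trans ?_ hi
      exact Finset.sum_congr rfl fun j _ => by ring
  funext j
  exact (mul_eq_zero.1 (congrFun hw j)).resolve_right (Nat.cast_add_one_ne_zero _)
end

section
/- Let k be an algebraically closed field of characteristic zero and let A be a finitely generated commutative k-algebra which is an integral domain with Krull dimension at least 2. Let D : A → A be a nonzero locally nilpotent k-derivation (for every a ∈ A there exists m with D^[m](a) = 0). Then the kernel of D, viewed as a k-subspace of A, is infinite-dimensional over k. -/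
open Polynomial in
/-- Every polynomial over a field of characteristic zero has an antiderivative. -/
theorem exists_polynomial_derivative_eq {k : Type*} [Field k] [CharZero k] (p : k[X]) :
    ∃ q : k[X], derivative q = p := by
  induction p using Polynomial.induction_on' with
  | add p₁ p₂ h₁ h₂ =>
    obtain ⟨q₁, rfl⟩ := h₁
    obtain ⟨q₂, rfl⟩ := h₂
    exact ⟨q₁ + q₂, derivative_add⟩
  | monomial n a =>
    refine ⟨monomial (n + 1) (a / (n + 1 : ℕ)), ?_⟩
    rw [derivative_monomial, div_mul_cancel₀ _ (Nat.cast_ne_zero.mpr n.succ_ne_zero),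
      Nat.add_sub_cancel]

namespace Derivation

/-- The kernel of a derivation, as a subalgebra. -/
def kerSubalgebra {k A : Type*} [CommRing k] [CommRing A] [Algebra k A]
    (D : Derivation k A A) : Subalgebra k A where
  carrier := {a | D a = 0}
  mul_mem' {a b} ha hb := by
    rw [Set.mem_ofPred_eq] at *
    simp [ha, hb]
  add_mem' {a b} ha hb := by
    rw [Set.mem_ofPred_eq] at *
    simp [ha, hb]
  algebraMap_mem' r := D.map_algebraMap r

/-- If the kernel of a derivation of a domain over an algebraically closed field is
finite-dimensional, then it consists of the scalars. -/
theorem exists_algebraMap_eq_of_finiteDimensional_ker {k A : Type*} [Field k] [IsAlgClosed k]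
    [CommRing A] [IsDomain A] [Algebra k A] (D : Derivation k A A)
    [hfin : FiniteDimensional k (LinearMap.ker D.toLinearMap)] {a : A} (ha : D a = 0) :
    ∃ c : k, algebraMap k A c = a := by
  have : Module.Finite k D.kerSubalgebra := hfin
  have hsurj : Function.Surjective (algebraMap k D.kerSubalgebra) :=
    (IsAlgClosed.algebraMap_bijective_of_isIntegral (k := k) (K := D.kerSubalgebra)).2
  obtain ⟨c, hc⟩ := hsurj ⟨a, ha⟩
  exact ⟨c, congrArg Subtype.val hc⟩

/-- A nonzero locally nilpotent derivation has a local slice. -/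
theorem exists_local_slice {k A : Type*} [CommRing k] [CommRing A] [Algebra k A]
    (D : Derivation k A A) (hD : D ≠ 0) (hln : ∀ a : A, ∃ m : ℕ, (⇑D)^[m] a = 0) :
    ∃ x : A, D x ≠ 0 ∧ D (D x) = 0 := by
  by_contra! h
  refine hD (Derivation.ext fun a => ?_)
  obtain ⟨m, hm⟩ := hln a
  induction m generalizing a with
  | zero =>
    rw [Function.iterate_zero, id_eq] at hm
    simp [hm]
  | succ m ih =>
    by_contra ha
    exact h a ha (ih (D a) hm)

open Polynomial in
/-- If the kernel of a locally nilpotent derivation consists of scalars, then `A` is generated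
by any slice. -/
theorem aeval_surjective_of_apply_eq_one {k A : Type*} [Field k] [CharZero k]
    [CommRing A] [Algebra k A] (D : Derivation k A A)
    (hln : ∀ a : A, ∃ m : ℕ, (⇑D)^[m] a = 0)
    (hker : ∀ a : A, D a = 0 → ∃ c : k, algebraMap k A c = a) {x : A} (hx : D x = 1) :
    Function.Surjective (aeval x : k[X] →ₐ[k] A) := by
  intro a
  obtain ⟨m, hm⟩ := hln a
  induction m generalizing a with
  | zero => exact ⟨0, by simpa using hm.symm⟩
  | succ m ih =>
    obtain ⟨p, hp⟩ := ih (D a) hm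
    obtain ⟨q, rfl⟩ := exists_polynomial_derivative_eq p
    obtain ⟨c, hc⟩ := hker (a - aeval x q) (by simp [Derivation.map_aeval, hx, hp])
    exact ⟨C c + q, by simp [hc]⟩

end Derivation

/-- If `A` is the coordinate ring of an irreducible affine variety of dimension at
least 2 over an algebraically closed field `k` of characteristic zero, and
`D : A → A` is a nonzero locally nilpotent `k`-derivation, then the kernel of `D`
is infinite-dimensional over `k`. -/
theorem ker_of_locally_nilpotent_derivation_infinite_dimensional
    (k A : Type) [Field k] [IsAlgClosed k] [CharZero k]
    [CommRing A] [IsDomain A] [Algebra k A] [Algebra.FiniteType k A]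
    (hdim : 2 ≤ ringKrullDim A)
    (D : Derivation k A A) (hD : D ≠ 0)
    (hln : ∀ a : A, ∃ m : ℕ, (⇑D)^[m] a = 0) :
    ¬ FiniteDimensional k (LinearMap.ker D.toLinearMap) := by
  intro hfin
  have hker (a : A) (ha : D a = 0) : ∃ c : k, algebraMap k A c = a :=
    D.exists_algebraMap_eq_of_finiteDimensional_ker ha
  obtain ⟨x, hx, hx'⟩ := D.exists_local_slice hD hln
  obtain ⟨c, hc⟩ := hker (D x) hx'
  have hc0 : c ≠ 0 := by
    rintro rfl
    exact hx (by rw [← hc, map_zero])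
  have hslice : D (c⁻¹ • x) = 1 := by
    rw [D.map_smul, ← hc, Algebra.smul_def, ← map_mul, inv_mul_cancel₀ hc0, map_one]
  have hle := ringKrullDim_le_of_surjective
    (Polynomial.aeval (c⁻¹ • x) : Polynomial k →ₐ[k] A).toRingHom
    (D.aeval_surjective_of_apply_eq_one hln hker hslice)
  rw [Polynomial.ringKrullDim_of_isNoetherianRing, ringKrullDim_eq_zero_of_field, zero_add] at hle
  exact absurd (hdim.trans hle) (by decide)
end

section
/- Let k be an algebraically closed field of characteristic zero and let A be a finitely generated commutative k-algebra which is an integral domain of Krull dimension 1. If there exists a nonzero locally nilpotent k-derivation D : A → A (for every a ∈ A there exists m with D^[m](a) = 0), then A is isomorphic as a k-algebra to the polynomial ring k[T] in one variable. -/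
open Polynomial

theorem Polynomial.derivative_surjective (k : Type*) [Field k] [CharZero k] :
    Function.Surjective (derivative : k[X] → k[X]) := by
  intro p
  induction p using Polynomial.induction_on' with
  | add p q hp hq =>
    obtain ⟨P, rfl⟩ := hp
    obtain ⟨Q, rfl⟩ := hq
    exact ⟨P + Q, by simp⟩
  | monomial n c =>
    refine ⟨monomial (n + 1) (c / (n + 1)), ?_⟩
    rw [derivative_monomial]
    have : (n + 1 : k) ≠ 0 := n.cast_add_one_ne_zero
    simp [div_mul_cancel₀ _ this]

/-- If `R → A` is an injective integral extension, then `dim R ≤ dim A`. -/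
theorem ringKrullDim_le_of_isIntegral (R A : Type*) [CommRing R] [CommRing A] [Algebra R A]
    [FaithfulSMul R A] [Algebra.IsIntegral R A] : ringKrullDim R ≤ ringKrullDim A := by
  refine iSup_le fun l ↦ ?_
  obtain ⟨P, -, hP, hPl⟩ := Ideal.exists_ideal_over_prime_of_isIntegral (S := A) l.head.asIdeal ⊥
    (by simp [← RingHom.ker_eq_comap_bot, (RingHom.injective_iff_ker_eq_bot _).mp
      (FaithfulSMul.algebraMap_injective R A)])
  have : P.LiesOver l.head.asIdeal := ⟨hPl.symm⟩
  obtain ⟨L, hL, -⟩ := Ideal.exists_ltSeries_of_hasGoingUp l P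
  rw [← hL]
  exact Order.LTSeries.length_le_krullDim L

namespace Algebra

/-- The transcendence degree of a finitely generated domain is at most its Krull dimension. -/
theorem trdeg_le_of_ringKrullDim_le (k A : Type*) [Field k] [CommRing A] [IsDomain A]
    [Algebra k A] [Algebra.FiniteType k A] {n : ℕ} (h : ringKrullDim A ≤ n) :
    Algebra.trdeg k A ≤ n := by
  obtain ⟨s, g, hinj, hint⟩ := exists_integral_inj_algHom_of_fg k A
  let := g.toRingHom.toAlgebra
  have : IsScalarTower k (MvPolynomial (Fin s) k) A := .of_algHom g
  have : FaithfulSMul (MvPolynomial (Fin s) k) A :=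
    (faithfulSMul_iff_algebraMap_injective _ _).mpr hinj
  have : Algebra.IsIntegral (MvPolynomial (Fin s) k) A := ⟨hint⟩
  have hs := (ringKrullDim_le_of_isIntegral (MvPolynomial (Fin s) k) A).trans h
  rw [MvPolynomial.ringKrullDim_of_isNoetherianRing, ringKrullDim_eq_zero_of_field, zero_add,
    Nat.card_fin] at hs
  have hs : s ≤ n := by exact_mod_cast hs
  have := lift_trdeg_add_eq k (MvPolynomial (Fin s) k) A
  simp only [MvPolynomial.trdeg_of_isDomain, trdeg_eq_zero, Cardinal.mk_fin, Cardinal.lift_natCast,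
    Cardinal.lift_zero, add_zero] at this
  rw [eq_comm, Cardinal.lift_eq_nat_iff] at this
  rw [this]
  exact_mod_cast hs

end Algebra

namespace Derivation

/-- An element on which a derivation does not vanish is transcendental over the constants. -/
theorem transcendental_of_apply_ne_zero {R A : Type*} [CommRing R] [CommRing A] [IsDomain A]
    [CharZero A] [Algebra R A] [FaithfulSMul R A] (D : Derivation R A A) {x : A} (hx : D x ≠ 0) :
    Transcendental R x := by
  have hinj := FaithfulSMul.algebraMap_injective R A
  have := hinj.isDomain
  have : CharZero R := (algebraMap R A).charZero
  rw [transcendental_iff]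
  intro p
  induction h : p.natDegree using Nat.strong_induction_on generalizing p with
  | _ n ih =>
    intro hp
    have hdeg : p.natDegree = 0 := by
      by_contra h0
      refine h0 (derivative_eq_zero.mp
        (ih _ (h ▸ natDegree_derivative_lt h0) _ rfl ?_))
      have := D.map_aeval p x
      simpa [hp, hx] using this
    rw [eq_C_of_natDegree_eq_zero hdeg] at hp ⊢
    simpa [hinj.eq_iff' (map_zero _)] using hp

section CommRing

variable {k A : Type*} [CommRing k] [CommRing A] [Algebra k A] (D : Derivation k A A)

/-- The kernel of a derivation, as a subalgebra. -/
def constants : Subalgebra k A where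
  carrier := {a | D a = 0}
  mul_mem' {a b} ha hb := by simp_all
  add_mem' {a b} ha hb := by simp_all
  algebraMap_mem' := D.map_algebraMap

theorem mem_constants {a : A} : a ∈ D.constants ↔ D a = 0 := .rfl

/-- A derivation is linear over its kernel. -/
def overConstants : Derivation D.constants A A :=
  .mk' { toFun := D
         map_add' := D.map_add
         map_smul' := fun c a ↦ by simp [Subalgebra.smul_def, D.mem_constants.mp c.2] }
    D.leibniz

theorem overConstants_apply (a : A) : D.overConstants a = D a := rfl

/-- A nonzero locally nilpotent derivation admits a local slice. -/
theorem exists_apply_ne_zero_apply_apply_eq_zero (hD : D ≠ 0) (hln : ∀ a, ∃ m : ℕ, D^[m] a = 0) :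
    ∃ s, D s ≠ 0 ∧ D (D s) = 0 := by
  obtain ⟨a, ha⟩ : ∃ a, D a ≠ 0 := by
    by_contra! h
    exact hD (Derivation.ext h)
  obtain ⟨m, hm⟩ := hln a
  induction m generalizing a with
  | zero => simp_all
  | succ m ih =>
    by_cases h : D (D a) = 0
    · exact ⟨a, ha, h⟩
    · exact ih (D a) h hm

end CommRing

section Field

variable {k A : Type*} [Field k] [CommRing A] [Algebra k A] (D : Derivation k A A)

/-- A nonzero derivation on a domain of transcendence degree at most one over an algebraically
closed field of characteristic zero has only scalar constants. -/
theorem constants_eq_bot [IsAlgClosed k] [CharZero k] [IsDomain A]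
    (hA : Algebra.trdeg k A ≤ 1) (hD : D ≠ 0) : D.constants = ⊥ := by
  have : CharZero A := charZero_of_injective_algebraMap (algebraMap k A).injective
  obtain ⟨a, ha⟩ : ∃ a, D a ≠ 0 := by
    by_contra! h
    exact hD (Derivation.ext h)
  have htr : Algebra.Transcendental D.constants A :=
    ⟨a, D.overConstants.transcendental_of_apply_ne_zero ha⟩
  have hpos := Cardinal.one_le_iff_pos.mpr (trdeg_pos D.constants A)
  have hadd := trdeg_add_eq k D.constants (A := A)
  have halg : Algebra.IsAlgebraic k D.constants := by
    rw [← trdeg_eq_zero_iff]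
    by_contra h
    have h1 := Cardinal.one_le_iff_ne_zero.mpr h
    have h2 := (add_le_add h1 hpos).trans (hadd.trans_le hA)
    norm_num at h2
  have : Algebra.IsIntegral k D.constants := Algebra.isAlgebraic_iff_isIntegral.mp halg
  refine eq_bot_iff.mpr fun c hc ↦ ?_
  obtain ⟨r, hr⟩ := (IsAlgClosed.algebraMap_bijective_of_isIntegral (k := k)).2
    (⟨c, hc⟩ : D.constants)
  exact ⟨r, congrArg Subtype.val hr⟩

/-- If the constants are `k` and `D s = 1`, then `A` is the polynomial ring in the slice `s`. -/
theorem aeval_bijective_of_slice [CharZero k] [IsDomain A]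
    (hc : D.constants = ⊥) (hln : ∀ a, ∃ m : ℕ, D^[m] a = 0) {s : A} (hs : D s = 1) :
    Function.Bijective (aeval s : k[X] →ₐ[k] A) := by
  have : CharZero A := charZero_of_injective_algebraMap (algebraMap k A).injective
  refine ⟨transcendental_iff_injective.mp (D.transcendental_of_apply_ne_zero (by simp [hs])), ?_⟩
  intro a
  obtain ⟨m, hm⟩ := hln a
  induction m generalizing a with
  | zero => exact ⟨0, by simpa using hm.symm⟩
  | succ m ih =>
    obtain ⟨p, hp⟩ := ih (D a) hm
    obtain ⟨q, rfl⟩ := derivative_surjective k p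
    have hmem : a - aeval s q ∈ D.constants := by
      rw [mem_constants, map_sub, map_aeval, hs, smul_eq_mul, mul_one, hp, sub_self]
    rw [hc, Algebra.mem_bot] at hmem
    obtain ⟨r, hr⟩ := hmem
    exact ⟨q + C r, by simp [hr]⟩

end Field

end Derivation

/-- An irreducible affine curve over an algebraically closed field of characteristic
zero admitting a nontrivial `𝔾ₐ`-action (i.e. whose coordinate ring `A` carries a
nonzero locally nilpotent derivation) is isomorphic to the affine line `𝔸¹`. -/
theorem curve_with_locally_nilpotent_derivation_is_affine_line
    (k A : Type) [Field k] [IsAlgClosed k] [CharZero k]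
    [CommRing A] [IsDomain A] [Algebra k A] [Algebra.FiniteType k A]
    (hdim : ringKrullDim A = 1)
    (D : Derivation k A A) (hD : D ≠ 0)
    (hln : ∀ a : A, ∃ m : ℕ, (⇑D)^[m] a = 0) :
    Nonempty (A ≃ₐ[k] Polynomial k) := by
  have htr : Algebra.trdeg k A ≤ 1 := by
    exact_mod_cast Algebra.trdeg_le_of_ringKrullDim_le k A (n := 1) (by simp [hdim])
  have hc := D.constants_eq_bot htr hD
  obtain ⟨s, hs, hss⟩ := D.exists_apply_ne_zero_apply_apply_eq_zero hD hln
  obtain ⟨r, hr⟩ : ∃ r, algebraMap k A r = D s := by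
    rwa [← D.mem_constants, hc, Algebra.mem_bot] at hss
  have hr0 : r ≠ 0 := by
    rintro rfl
    exact hs (by rw [← hr, map_zero])
  have hslice : D (r⁻¹ • s) = 1 := by
    rw [D.map_smul, ← hr, Algebra.algebraMap_eq_smul_one, smul_smul, inv_mul_cancel₀ hr0, one_smul]
  exact ⟨(AlgEquiv.ofBijective _ (D.aeval_bijective_of_slice hc hln hslice)).symm⟩
end

section
/- Let k be an algebraically closed field of characteristic zero. Let A and B be finitely generated commutative k-algebras which are integral domains, and assume B is integrally closed (in its fraction field). Let ι : B → A be an injective k-algebra homomorphism which is surjective on k-points: for every k-algebra homomorphism y : B → k there exists a k-algebra homomorphism x : A → k with x ∘ ι = y. Let g ∈ A be an element which is constant on the fibers of ι on k-points: for all k-algebra homomorphisms x, x' : A → k with x ∘ ι = x' ∘ ι one has x(g) = x'(g). Then g lies in the image of ι. -/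
open scoped TensorProduct

section

variable {k R : Type*} [Field k] [IsAlgClosed k] [CommRing R] [Algebra k R]
  [Algebra.FiniteType k R]

theorem isNilpotent_of_forall_algHom_eq_zero {r : R} (h : ∀ x : R →ₐ[k] k, x r = 0) :
    IsNilpotent r := by
  have : IsJacobsonRing R := isJacobsonRing_of_finiteType (A := k)
  rw [← mem_nilradical, nilradical, Ideal.radical_eq_jacobson, Ideal.jacobson, Ideal.mem_sInf]
  rintro m ⟨-, hm⟩
  let := Ideal.Quotient.field m
  have : Module.Finite k (R ⧸ m) := finite_of_finite_type_of_isJacobsonRing k (R ⧸ m)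
  let e := AlgEquiv.ofBijective (Algebra.ofId k (R ⧸ m))
    IsAlgClosed.algebraMap_bijective_of_isIntegral
  have hr := h (e.symm.toAlgHom.comp (Ideal.Quotient.mkₐ k m))
  exact Ideal.Quotient.eq_zero_iff_mem.mp (e.symm.map_eq_zero_iff.mp hr)

theorem Ideal.IsPrime.exists_algHom_ne_zero {p : Ideal R} (hp : p.IsPrime) {s : R} (hs : s ∉ p) :
    ∃ y : R →ₐ[k] k, (∀ t ∈ p, y t = 0) ∧ y s ≠ 0 := by
  by_contra! h
  refine hs (Ideal.Quotient.eq_zero_iff_mem.mp (IsNilpotent.eq_zero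
    (isNilpotent_of_forall_algHom_eq_zero (k := k) fun x ↦ ?_)))
  exact h (x.comp (Ideal.Quotient.mkₐ k p)) fun t ht ↦ by
    simp [Ideal.Quotient.eq_zero_iff_mem.mpr ht]

end

section

variable {K L E M : Type*} [Field K] [Field L] [Algebra K L] [CommRing E] [Algebra K E]
  [CommRing M] [IsDomain M] [Algebra K M]

theorem AlgHom.apply_eq_of_isNilpotent_tmul_sub_tmul (f : E →ₐ[K] L)
    (hf : Function.Injective f) {e : E}
    (he : IsNilpotent (f e ⊗ₜ[K] (1 : L) - (1 : L) ⊗ₜ[K] f e)) (φ ψ : E →ₐ[K] M) :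
    φ e = ψ e := by
  have hinj : Function.Injective (Algebra.TensorProduct.map f f) :=
    TensorProduct.map_injective_of_flat_flat f.toLinearMap f.toLinearMap hf hf
  have he' : IsNilpotent (e ⊗ₜ[K] (1 : E) - (1 : E) ⊗ₜ[K] e) := by
    rw [← IsNilpotent.map_iff hinj]
    simpa using he
  simpa [sub_eq_zero] using (he'.map (Algebra.TensorProduct.productMap φ ψ)).eq_zero

theorem mem_range_algebraMap_of_isNilpotent_tmul_sub_tmul [CharZero K] {g : L}
    (hg : IsNilpotent (g ⊗ₜ[K] (1 : L) - (1 : L) ⊗ₜ[K] g)) :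
    g ∈ Set.range (algebraMap K L) := by
  by_cases hgK : IsAlgebraic K g
  · have hint := hgK.isIntegral
    have : FiniteDimensional K (IntermediateField.adjoin K {g}) :=
      IntermediateField.adjoin.finiteDimensional hint
    have : Subsingleton (IntermediateField.adjoin K {g} →ₐ[K] AlgebraicClosure K) :=
      ⟨fun φ ψ ↦ (IntermediateField.adjoin.powerBasis hint).algHom_ext <|
        AlgHom.apply_eq_of_isNilpotent_tmul_sub_tmul (IntermediateField.adjoin K {g}).val
          Subtype.val_injective (by simpa using hg) φ ψ⟩
    have hcard := AlgHom.card K (IntermediateField.adjoin K {g}) (AlgebraicClosure K)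
    have hone : Module.finrank K (IntermediateField.adjoin K {g}) = 1 :=
      le_antisymm (hcard ▸ Fintype.card_le_one_iff_subsingleton.mpr this) Module.finrank_pos
    exact IntermediateField.mem_bot.mp
      (IntermediateField.finrank_adjoin_simple_eq_one_iff.mp hone)
  · have h := AlgHom.apply_eq_of_isNilpotent_tmul_sub_tmul (Polynomial.aeval (R := K) g)
      (transcendental_iff_injective.mp hgK) (e := Polynomial.X) (by simpa using hg)
      (Polynomial.aeval (0 : K)) (Polynomial.aeval (1 : K))
    simp at h

end

theorem exists_mul_eq_of_isNilpotent_tmul_sub_tmul {A B : Type*} [CommRing A] [IsDomain A]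
    [CommRing B] [IsDomain B] [CharZero B] [Algebra B A] [FaithfulSMul B A] {g : A}
    (hg : IsNilpotent (g ⊗ₜ[B] (1 : A) - (1 : A) ⊗ₜ[B] g)) :
    ∃ b c : B, b ≠ 0 ∧ algebraMap B A b * g = algebraMap B A c := by
  let K := FractionRing B
  let L := FractionRing A
  let : Algebra K L := FractionRing.liftAlgebra B L
  have : IsScalarTower B K L := FractionRing.isScalarTower_liftAlgebra B L
  have : CharZero K := charZero_of_injective_algebraMap (IsFractionRing.injective B K)
  let φ : A ⊗[B] A →ₐ[B] L ⊗[K] L := Algebra.TensorProduct.lift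
    ((Algebra.TensorProduct.includeLeft (R := K) (S := B) (A := L) (B := L)).comp
      (IsScalarTower.toAlgHom B A L))
    (((Algebra.TensorProduct.includeRight (R := K) (A := L) (B := L)).restrictScalars B).comp
      (IsScalarTower.toAlgHom B A L)) fun _ _ ↦ Commute.all _ _
  obtain ⟨q, hq⟩ := mem_range_algebraMap_of_isNilpotent_tmul_sub_tmul (K := K)
    (g := algebraMap A L g) (by simpa [φ] using hg.map φ)
  obtain ⟨c, b, hb, rfl⟩ := IsFractionRing.div_surjective (A := B) q
  refine ⟨b, c, nonZeroDivisors.ne_zero hb, IsFractionRing.injective A L ?_⟩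
  have hb' : algebraMap B L b ≠ 0 := by
    simpa using nonZeroDivisors.ne_zero hb
  rw [map_mul, ← hq, map_div₀, ← IsScalarTower.algebraMap_apply, ← IsScalarTower.algebraMap_apply,
    ← IsScalarTower.algebraMap_apply, ← IsScalarTower.algebraMap_apply, mul_div_cancel₀ _ hb']

theorem IsIntegrallyClosed.mem_range_algebraMap_of_mul_eq {A B : Type*} [CommRing A] [IsDomain A]
    [CommRing B] [IsDomain B] [IsIntegrallyClosed B] [Algebra B A] [FaithfulSMul B A]
    {f : A} (hf : IsIntegral B f) {b c : B} (hb : b ≠ 0)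
    (h : algebraMap B A b * f = algebraMap B A c) : f ∈ Set.range (algebraMap B A) := by
  have hdvd : b ∣ c := by
    let K := FractionRing B
    let L := FractionRing A
    let : Algebra K L := FractionRing.liftAlgebra B L
    have : IsScalarTower B K L := FractionRing.isScalarTower_liftAlgebra B L
    have hbK : algebraMap B K b ≠ 0 := by simpa using hb
    have hbL : algebraMap B L b ≠ 0 := by simpa using hb
    have hfL : algebraMap K L (algebraMap B K c / algebraMap B K b) = algebraMap A L f := by
      rw [map_div₀, ← IsScalarTower.algebraMap_apply, ← IsScalarTower.algebraMap_apply,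
        div_eq_iff hbL, IsScalarTower.algebraMap_apply B A L, IsScalarTower.algebraMap_apply B A L,
        ← h, map_mul, mul_comm]
    have hint : IsIntegral B (algebraMap B K c / algebraMap B K b) := by
      rw [← isIntegral_algebraMap_iff (algebraMap K L).injective, hfL]
      exact hf.algebraMap
    obtain ⟨d, hd⟩ := IsIntegrallyClosed.algebraMap_eq_of_integral hint
    refine ⟨d, IsFractionRing.injective B K ?_⟩
    rw [map_mul, hd, mul_div_cancel₀ _ hbK]
  obtain ⟨d, rfl⟩ := hdvd
  refine ⟨d, mul_left_cancel₀ (a := algebraMap B A b) (by simpa using hb) ?_⟩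
  rw [h, map_mul]

/-- If `g` is a fraction over a Noetherian normal domain `B` but not in `B`, then some prime of `B`
has an element outside it which becomes a multiple in `A` of an element of the prime. -/
theorem exists_isPrime_of_notMem_range {A B : Type*} [CommRing A] [IsDomain A]
    [CommRing B] [IsDomain B] [IsIntegrallyClosed B] [IsNoetherianRing B] [Algebra B A]
    [FaithfulSMul B A] {g : A} {b c : B} (hb : b ≠ 0)
    (h : algebraMap B A b * g = algebraMap B A c) (hg : g ∉ Set.range (algebraMap B A)) :
    ∃ p : Ideal B, p.IsPrime ∧ ∃ t ∈ p, ∃ s ∉ p,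
      algebraMap B A s ∈ Ideal.span {algebraMap B A t} := by
  let N : Submodule B A := LinearMap.range (Algebra.linearMap B A)
  have hN (a : A) : a ∈ N ↔ a ∈ Set.range (algebraMap B A) := Iff.rfl
  let Q := Submodule.span B {N.mkQ g}
  let x : Q := ⟨N.mkQ g, Submodule.mem_span_singleton_self _⟩
  have hx : x ≠ 0 := fun hx ↦ hg ((hN g).mp
    ((Submodule.Quotient.mk_eq_zero N).mp (congrArg Subtype.val hx)))
  obtain ⟨p, hp, -⟩ := exists_le_isAssociatedPrime_of_isNoetherianRing B x hx
  have hprime := hp.isPrime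
  obtain ⟨-, ⟨y, hy⟩, hpy⟩ := isAssociatedPrime_iff.mp hp
  obtain ⟨d, rfl⟩ := Submodule.mem_span_singleton.mp hy
  have hmem (s : B) : s ∈ p ↔ s • d • g ∈ Set.range (algebraMap B A) := by
    rw [← hN, ← Submodule.Quotient.mk_eq_zero N, hpy, Submodule.mem_colon_singleton,
      Submodule.mem_bot, Subtype.ext_iff]
    rfl
  have hbf : algebraMap B A b * (d • g) = algebraMap B A (d * c) := by
    rw [mul_smul_comm, h, Algebra.smul_def, map_mul]
  have hbp : b ∈ p := (hmem b).mpr ⟨d * c, by rw [← hbf, ← Algebra.smul_def]⟩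
  refine ⟨p, hprime, ?_⟩
  by_contra! hcon
  have hint : IsIntegral B (d • g) := by
    refine isIntegral_of_smul_mem_submodule (Submodule.map (Algebra.linearMap B A) p) ?_
      ((IsNoetherian.noetherian p).map _) _ ?_
    · exact (Submodule.ne_bot_iff _).mpr ⟨_, ⟨b, hbp, rfl⟩, by simpa using hb⟩
    · rintro _ ⟨t, ht, rfl⟩
      obtain ⟨s, hs⟩ := (hmem t).mp ht
      have hs' : algebraMap B A s = d • g * algebraMap B A t := by
        rw [hs, Algebra.smul_def, mul_comm]
      refine ⟨s, ?_, hs'⟩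
      by_contra hsp
      exact hcon t ht s hsp (hs' ▸ Ideal.mul_mem_left _ _ (Ideal.mem_span_singleton_self _))
  have hone : (1 : B) ∈ p := (hmem 1).mpr <| by
    simpa using IsIntegrallyClosed.mem_range_algebraMap_of_mul_eq hint hb hbf
  exact hprime.ne_top ((Ideal.eq_top_iff_one p).mpr hone)


/-- Coordinate-ring form of: if `μ : X → Y` is a surjective morphism of irreducible
affine varieties with `Y` normal, and a function `g` on `X` is constant on the fibers
of `μ`, then `g` is pulled back from a regular function on `Y`. -/
theorem constant_on_fibers_mem_range
    (k A B : Type) [Field k] [IsAlgClosed k] [CharZero k]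
    [CommRing A] [IsDomain A] [Algebra k A] [Algebra.FiniteType k A]
    [CommRing B] [IsDomain B] [Algebra k B] [Algebra.FiniteType k B]
    [IsIntegrallyClosed B]
    (ι : B →ₐ[k] A) (hinj : Function.Injective ι)
    (hsurj : ∀ y : B →ₐ[k] k, ∃ x : A →ₐ[k] k, x.comp ι = y)
    (g : A)
    (hg : ∀ x x' : A →ₐ[k] k, x.comp ι = x'.comp ι → x g = x' g) :
    g ∈ Set.range ι := by
  algebraize [ι.toRingHom]
  have : IsScalarTower k B A := .of_algebraMap_eq fun r ↦ (ι.commutes r).symm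
  have : FaithfulSMul B A := (faithfulSMul_iff_algebraMap_injective B A).mpr hinj
  have : CharZero B := charZero_of_injective_algebraMap (algebraMap k B).injective
  have : IsNoetherianRing B := Algebra.FiniteType.isNoetherianRing k B
  have : Algebra.FiniteType B A := .of_restrictScalars_finiteType k B A
  have : Algebra.FiniteType k (A ⊗[B] A) := .trans ‹Algebra.FiniteType k A› inferInstance
  have hnil : IsNilpotent (g ⊗ₜ[B] (1 : A) - (1 : A) ⊗ₜ[B] g) := by
    refine isNilpotent_of_forall_algHom_eq_zero (k := k) fun x ↦ ?_
    rw [map_sub, sub_eq_zero]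
    refine hg (x.comp Algebra.TensorProduct.includeLeft)
      (x.comp (Algebra.TensorProduct.includeRight.restrictScalars k)) ?_
    ext b
    exact congrArg x (Algebra.TensorProduct.tmul_one_eq_one_tmul b)
  obtain ⟨b, c, hb, hbc⟩ := exists_mul_eq_of_isNilpotent_tmul_sub_tmul hnil
  by_contra hgB
  obtain ⟨p, hp, t, ht, s, hs, hst⟩ := exists_isPrime_of_notMem_range hb hbc hgB
  obtain ⟨y, hyp, hys⟩ := hp.exists_algHom_ne_zero (k := k) hs
  obtain ⟨x, rfl⟩ := hsurj y
  obtain ⟨a, ha⟩ := Ideal.mem_span_singleton'.mp hst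
  have hxt : x (algebraMap B A t) = 0 := hyp t ht
  have hxs : x (algebraMap B A s) = 0 := by rw [← ha, map_mul, hxt, mul_zero]
  exact hys hxs
end

section
/- Let k be a field, n ≥ 1, and let R = k[x₁^{±1},…,xₙ^{±1}] be the Laurent polynomial ring in n variables, i.e. the group algebra of ℤⁿ over k (AddMonoidAlgebra k (Fin n → ℤ)). Then for every k-algebra automorphism φ of R there exist an n×n integer matrix M with det M = ±1 (i.e. IsUnit (M.det) in ℤ) and units c₁,…,cₙ ∈ kˣ such that for each i, φ maps the i-th variable x_i to c_i times the monomial whose exponent vector is the i-th column of M: φ(x_i) = c_i · x₁^{M₁ᵢ}·x₂^{M₂ᵢ}⋯xₙ^{Mₙᵢ}. -/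
namespace AddMonoidAlgebra

/-- A right-invertible element of the monoid algebra of a monoid with two unique sums, over a
semiring without zero divisors, is a nonzero scalar multiple of a monomial. -/
theorem exists_eq_single_of_mul_eq_one {R A : Type*} [Semiring R] [Nontrivial R]
    [NoZeroDivisors R] [AddMonoid A] [TwoUniqueSums A] {f g : AddMonoidAlgebra R A}
    (h : f * g = 1) : ∃ (a : A) (r : R), r ≠ 0 ∧ f = single a r := by
  classical
  have hf : f ≠ 0 := by rintro rfl; simp at h
  have hg : g ≠ 0 := by rintro rfl; simp at h
  have hf' : 0 < f.coeff.support.card := by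
    simpa [Finset.card_pos, Finsupp.support_nonempty_iff] using hf
  have hg' : 0 < g.coeff.support.card := by
    simpa [Finset.card_pos, Finsupp.support_nonempty_iff] using hg
  have eq_zero {a b : A} (ha : a ∈ f.coeff.support) (hb : b ∈ g.coeff.support)
      (hu : UniqueAdd f.coeff.support g.coeff.support a b) : a + b = 0 := by
    by_contra hab
    have hc := coeff_mul_add_of_uniqueAdd hu
    rw [h, one_def, coeff_single, Finsupp.single_eq_of_ne hab] at hc
    exact mul_ne_zero (Finsupp.mem_support_iff.mp ha) (Finsupp.mem_support_iff.mp hb) hc.symm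
  have hcard : f.coeff.support.card * g.coeff.support.card ≤ 1 := by
    by_contra! hlt
    obtain ⟨p, hp, q, hq, hpq, hup, huq⟩ := TwoUniqueSums.uniqueAdd_of_one_lt_card hlt
    rw [Finset.mem_product] at hp hq
    have := hup hq.1 hq.2 ((eq_zero hq.1 hq.2 huq).trans (eq_zero hp.1 hp.2 hup).symm)
    exact hpq (Prod.ext this.1 this.2).symm
  obtain ⟨a, r, hr, hs⟩ := Finsupp.card_support_eq_one'.mp
    (show f.coeff.support.card = 1 by nlinarith)
  exact ⟨a, r, hr, coeff_injective (by rw [hs, coeff_single])⟩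

/-- An algebra homomorphism between group algebras sends monomials to nonzero scalar multiples
of monomials, the exponents being given by an additive homomorphism. -/
theorem exists_addMonoidHom_map_single {R A B : Type*} [CommRing R] [IsDomain R] [AddGroup A]
    [AddGroup B] [TwoUniqueSums B] (φ : AddMonoidAlgebra R A →ₐ[R] AddMonoidAlgebra R B) :
    ∃ d : A →+ B, ∀ a, ∃ r : R, r ≠ 0 ∧ φ (single a 1) = single (d a) r := by
  have hmul (a b : A) : φ (single a 1) * φ (single b 1) = φ (single (a + b) 1) := by
    rw [← map_mul, single_mul_single, one_mul]
  have hmono (a : A) : ∃ (b : B) (r : R), r ≠ 0 ∧ φ (single a 1) = single b r := by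
    refine exists_eq_single_of_mul_eq_one (g := φ (single (-a) 1)) ?_
    rw [hmul, add_neg_cancel, ← one_def, map_one]
  choose d r hr hd using hmono
  refine ⟨AddMonoidHom.mk' d fun a b ↦ ?_, fun a ↦ ⟨r a, hr a, hd a⟩⟩
  have h := hmul a b
  rw [hd, hd, hd, single_mul_single] at h
  exact ((single_inj.mp h).resolve_right fun h0 ↦ hr _ h0.2).1.symm

/-- If an algebra homomorphism acts on the exponents of monomials by `d` and a left inverse of it
acts by `e`, then `e` is a left inverse of `d`. -/
theorem leftInverse_of_map_single {R A B : Type*} [CommSemiring R] [Nontrivial R]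
    [AddMonoid A] [AddMonoid B] {φ : AddMonoidAlgebra R A →ₐ[R] AddMonoidAlgebra R B}
    {ψ : AddMonoidAlgebra R B →ₐ[R] AddMonoidAlgebra R A} (hψφ : Function.LeftInverse ψ φ)
    {d : A → B} {e : B → A} (hd : ∀ a, ∃ r : R, r ≠ 0 ∧ φ (single a 1) = single (d a) r)
    (he : ∀ b, ∃ r : R, r ≠ 0 ∧ ψ (single b 1) = single (e b) r) :
    Function.LeftInverse e d := by
  intro a
  obtain ⟨r, -, hra⟩ := hd a
  obtain ⟨s, -, hsa⟩ := he (d a)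
  have h := hψφ (single a 1)
  rw [hra, show single (d a) r = r • single (d a) (1 : R) by simp, map_smul, hsa] at h
  rw [smul_single] at h
  exact ((single_inj.mp h).resolve_right fun h0 ↦ one_ne_zero h0.2).1

end AddMonoidAlgebra

/-- Every `k`-algebra automorphism of the `n`-variable Laurent polynomial ring
(the group algebra of `ℤⁿ`) is given by a matrix `M ∈ GLₙ(ℤ)` together with units
`c₁,…,cₙ ∈ kˣ`: it maps `x_i` to `c_i` times the monomial with exponent vector the
`i`-th column of `M`. This is `Aut((𝔾ₘ)ⁿ) ≃ GLₙ(ℤ) ⋉ (kˣ)ⁿ`. -/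
theorem torus_automorphism_form
    (k : Type) [Field k] (n : ℕ) (hn : 1 ≤ n)
    (φ : AddMonoidAlgebra k (Fin n → ℤ) ≃ₐ[k] AddMonoidAlgebra k (Fin n → ℤ)) :
    ∃ M : Matrix (Fin n) (Fin n) ℤ, IsUnit M.det ∧
      ∃ c : Fin n → kˣ, ∀ i : Fin n,
        φ (AddMonoidAlgebra.single (Pi.single i 1) 1) =
          (c i : k) • AddMonoidAlgebra.single (fun j => M j i) 1 := by
  obtain ⟨d, hd⟩ := AddMonoidAlgebra.exists_addMonoidHom_map_single φ.toAlgHom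
  obtain ⟨e, he⟩ := AddMonoidAlgebra.exists_addMonoidHom_map_single φ.symm.toAlgHom
  have hed : Function.LeftInverse e d :=
    AddMonoidAlgebra.leftInverse_of_map_single (φ := φ.toAlgHom)
      (ψ := φ.symm.toAlgHom) φ.symm_apply_apply hd he
  refine ⟨LinearMap.toMatrix' d.toIntLinearMap, ?_, ?_⟩
  · refine (Matrix.isUnit_iff_isUnit_det _).mp
      (IsUnit.of_mul_eq_one_right (LinearMap.toMatrix' e.toIntLinearMap) ?_)
    rw [← LinearMap.toMatrix'_mul, ← LinearMap.toMatrix'_one]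
    exact congrArg _ (LinearMap.ext hed)
  · choose r hr hdr using hd
    refine ⟨fun i ↦ Units.mk0 (r (Pi.single i 1)) (hr _), fun i ↦ ?_⟩
    have hcol : (fun j ↦ LinearMap.toMatrix' d.toIntLinearMap j i) = d (Pi.single i 1) := by
      ext j
      simp [LinearMap.toMatrix'_apply]
    rw [hcol, AddMonoidAlgebra.smul_single, Units.val_mk0, smul_eq_mul, mul_one]
    exact hdr _
end

section
/- Let k be a field and n ≥ 1. For every point c = (c₁,…,c_{n−1}) ∈ k^{n−1}, the quotient of the polynomial ring k[x₁,…,xₙ] by the ideal generated by s₁ − c₁, s₂ − c₂, …, s_{n−1} − c_{n−1} has Krull dimension exactly 1. -/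
open MvPolynomial in
/-- If `B → A` hits the images of all elementary symmetric polynomials under a surjection
`k[xᵢ : i ∈ σ] → A`, then `A` is integral over `B`. -/
theorem RingHom.isIntegral_of_esymm_mem_range {σ k A B : Type*} [Fintype σ] [CommRing k]
    [CommRing A] [CommRing B] [Algebra k A] [Algebra k B] (f : B →ₐ[k] A)
    (φ : MvPolynomial σ k →ₐ[k] A) (hφ : Function.Surjective φ)
    (h : ∀ j, φ (esymm σ k j) ∈ f.range) : f.toRingHom.IsIntegral := by
  classical
  intro a
  obtain ⟨p, rfl⟩ := hφ a
  induction p using MvPolynomial.induction_on with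
  | C r =>
    rw [← algebraMap_eq, φ.commutes, ← f.commutes]
    exact f.toRingHom.isIntegralElem_map
  | add p q hp hq => rw [map_add]; exact hp.add _ hq
  | mul_X p i hp =>
    rw [map_mul]
    refine hp.mul _ ?_
    let P : Polynomial (MvPolynomial σ k) := ∏ i : σ, (Polynomial.X - Polynomial.C (X i))
    have hP : P.Monic := Polynomial.monic_prod_of_monic _ _ fun i _ => Polynomial.monic_X_sub_C _
    have hcard : (Finset.univ.val.map (X : σ → MvPolynomial σ k)).card = Fintype.card σ := by simp
    have hlift : P.map φ.toRingHom ∈ Polynomial.lifts f.toRingHom := by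
      rw [show P = ∑ j ∈ Finset.range (Fintype.card σ + 1), (-1) ^ j *
          (Polynomial.C (esymm σ k j) * Polynomial.X ^ (Fintype.card σ - j)) by
        rw [← hcard, esymm_eq_multiset_esymm, ← Multiset.prod_X_sub_X_eq_sum_esymm,
          Multiset.map_map]
        rfl]
      rw [Polynomial.map_sum]
      refine Subsemiring.sum_mem _ fun j _ => ?_
      obtain ⟨b, hb⟩ := h j
      refine ⟨(-1) ^ j * (Polynomial.C b * Polynomial.X ^ (Fintype.card σ - j)), ?_⟩
      have hb' : f b = φ (esymm σ k j) := hb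
      simp [hb']
    obtain ⟨Q, hQ, -, hQm⟩ := Polynomial.lifts_and_natDegree_eq_and_monic hlift (hP.map _)
    refine ⟨Q, hQm, ?_⟩
    rw [← Polynomial.eval_map, hQ, Polynomial.eval_map]
    change Polynomial.eval₂ φ.toRingHom (φ.toRingHom (X i)) P = 0
    rw [Polynomial.eval₂_at_apply, Polynomial.eval_prod, Finset.prod_eq_zero (Finset.mem_univ i),
      map_zero]
    simp

/-- An injective integral ring homomorphism preserves Krull dimension. -/
theorem RingHom.IsIntegral.ringKrullDim_eq {R S : Type*} [CommRing R] [CommRing S] {f : R →+* S}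
    (hf : f.IsIntegral) (hinj : Function.Injective f) : ringKrullDim S = ringKrullDim R := by
  algebraize [f]
  apply le_antisymm
  · exact Order.krullDim_le_of_strictMono (PrimeSpectrum.comap (algebraMap R S))
      fun I J h => Ideal.IsIntegral.comap_lt_comap (R := R) h
  · refine iSup_le fun l => ?_
    obtain ⟨P, hP⟩ := hf.comap_surjective hinj l.head
    have : P.asIdeal.LiesOver l.head.asIdeal := ⟨(congrArg PrimeSpectrum.asIdeal hP).symm⟩
    obtain ⟨L, hL, -⟩ := Ideal.exists_ltSeries_of_hasGoingUp l P.asIdeal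
    exact hL ▸ Order.LTSeries.length_le_krullDim L

open MvPolynomial in
/-- The last elementary symmetric polynomial is transcendental modulo prescribed values of the
other ones. -/
theorem MvPolynomial.aeval_esymm_injective_quotient {k : Type*} [Field k] {m : ℕ} (c : Fin m → k) :
    Function.Injective (Polynomial.aeval (R := k) (Ideal.Quotient.mk
      (Ideal.span (Set.range fun j : Fin m => esymm (Fin (m + 1)) k ((j : ℕ) + 1) - C (c j)))
      (esymm (Fin (m + 1)) k (m + 1)))) := by
  let ι : MvPolynomial (Fin (m + 1)) k →ₐ[k] MvPolynomial (Fin (m + 1)) k :=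
    aeval fun i => esymm (Fin (m + 1)) k (i + 1)
  have hι : Function.Injective ι := by
    intro p q h
    apply esymmAlgHom_fin_injective (m := m + 1) k le_rfl
    apply Subtype.ext
    simpa only [esymmAlgHom_apply] using h
  have hint : ι.toRingHom.IsIntegral := by
    refine RingHom.isIntegral_of_esymm_mem_range ι (AlgHom.id k _) Function.surjective_id ?_
    rintro (_ | j)
    · simp
    · by_cases hj : j < m + 1
      · exact ⟨X ⟨j, hj⟩, by simp [ι]⟩
      · rw [esymm, Finset.powersetCard_eq_empty.2 (by simp; omega)]
        simp
  let ψ : MvPolynomial (Fin (m + 1)) k →ₐ[k] Polynomial k :=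
    aeval (Fin.snoc (fun j => Polynomial.C (c j)) Polynomial.X)
  obtain ⟨⟨Q, hQ⟩, hQψ⟩ := hint.comap_surjective hι
    ⟨RingHom.ker ψ.toRingHom, RingHom.ker_isPrime ψ.toRingHom⟩
  have hmem (p) : ι p ∈ Q ↔ ψ p = 0 := SetLike.ext_iff.1 (congrArg PrimeSpectrum.asIdeal hQψ) p
  rw [injective_iff_map_eq_zero]
  intro p hp
  rw [← Ideal.Quotient.mkₐ_eq_mk k, Polynomial.aeval_algHom_apply, Ideal.Quotient.mkₐ_eq_mk,
    Ideal.Quotient.eq_zero_iff_mem] at hp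
  have hle : Ideal.span (Set.range fun j : Fin m =>
      esymm (Fin (m + 1)) k ((j : ℕ) + 1) - C (c j)) ≤ Q := by
    rw [Ideal.span_le]
    rintro _ ⟨j, rfl⟩
    have := (hmem (X j.castSucc - C (c j))).2 (by simp [ψ])
    simpa [ι] using this
  have h := (hmem (Polynomial.aeval (X (Fin.last m)) p)).1 (by
    rw [← Polynomial.aeval_algHom_apply]
    simpa [ι] using hle hp)
  rw [← Polynomial.aeval_algHom_apply] at h
  simpa [ψ] using h

/-- Every fiber of the morphism `φ = (s₁,…,s_{n-1}) : 𝔸ⁿ → 𝔸^{n-1}` given by the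
first `n - 1` elementary symmetric polynomials is a curve: the quotient of
`k[x₁,…,xₙ]` by the ideal `(s₁ - c₁, …, s_{n-1} - c_{n-1})` has Krull dimension 1. -/
theorem fiber_of_elementary_symmetric_krullDim_one
    (k : Type) [Field k] (n : ℕ) (hn : 1 ≤ n) (c : Fin (n - 1) → k) :
    ringKrullDim (MvPolynomial (Fin n) k ⧸
      Ideal.span (Set.range fun j : Fin (n - 1) =>
        MvPolynomial.esymm (Fin n) k ((j : ℕ) + 1) - MvPolynomial.C (c j))) = 1 := by
  obtain ⟨m, rfl⟩ := Nat.exists_eq_add_of_le' hn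
  have hint := RingHom.isIntegral_of_esymm_mem_range (Polynomial.aeval (R := k) (Ideal.Quotient.mk
      (Ideal.span (Set.range fun j : Fin m =>
        MvPolynomial.esymm (Fin (m + 1)) k ((j : ℕ) + 1) - MvPolynomial.C (c j)))
      (MvPolynomial.esymm (Fin (m + 1)) k (m + 1))))
    (Ideal.Quotient.mkₐ k _) (Ideal.Quotient.mkₐ_surjective k _) ?_
  · refine (hint.ringKrullDim_eq (MvPolynomial.aeval_esymm_injective_quotient c)).trans ?_
    exact IsPrincipalIdealRing.ringKrullDim_eq_one _ (Polynomial.not_isField k)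
  · rintro (_ | j)
    · simp
    · obtain hj | rfl | hj := lt_trichotomy j m
      · refine ⟨Polynomial.C (c ⟨j, hj⟩), ?_⟩
        refine (Polynomial.aeval_C _ _).trans ?_
        refine ((Ideal.Quotient.mk_eq_mk_iff_sub_mem _ _).2 ?_).symm
        exact Ideal.subset_span ⟨⟨j, hj⟩, rfl⟩
      · exact ⟨Polynomial.X, by simp⟩
      · have h0 : MvPolynomial.esymm (Fin (m + 1)) k (j + 1) = 0 := by
          rw [MvPolynomial.esymm, Finset.powersetCard_eq_empty.2 (by simp; omega),
            Finset.sum_empty]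
        rw [h0, map_zero]
        exact zero_mem _
end
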